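/- arXiv:1002.4157 — 9 statements merged into one kernel-verified Lean document; each statement's English description precedes it below -/
import Mathlib

section
/- For every w ∈ ℂ with Re(w) > 0 one has Re(1/(1 − e^{−w}) − 1/w − 1/2) > 0; and for every purely imaginary w = iv with v ∈ ℝ and cos v ≠ 1 one has Re(1/(1 − e^{−w}) − 1/w − 1/2) = 0. -/
open Complex

theorem Real.sinh_lt_self_mul_cosh {t : ℝ} (ht : 0 < t) : Real.sinh t < t * Real.cosh t := by
  have hd : ∀ s : ℝ, HasDerivAt (fun s => s * Real.cosh s - Real.sinh s) (s * Real.sinh s) s := by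
    intro s
    exact (((hasDerivAt_id' s).mul (Real.hasDerivAt_cosh s)).sub
      (Real.hasDerivAt_sinh s)).congr_deriv (by ring)
  have hmono : StrictMonoOn (fun s => s * Real.cosh s - Real.sinh s) (Set.Ici (0 : ℝ)) := by
    refine strictMonoOn_of_deriv_pos (convex_Ici 0)
      (fun s _ => (hd s).continuousAt.continuousWithinAt) fun s hs => ?_
    rw [interior_Ici, Set.mem_Ioi] at hs
    rw [(hd s).deriv]
    exact mul_pos hs (Real.sinh_pos_iff.2 hs)
  have h := hmono Set.self_mem_Ici ht.le ht
  simp only [Real.sinh_zero, zero_mul, sub_zero] at h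
  linarith

theorem Real.two_mul_cosh_sub_one_lt_mul_sinh {x : ℝ} (hx : 0 < x) :
    2 * (Real.cosh x - 1) < x * Real.sinh x := by
  obtain ⟨t, rfl⟩ : ∃ t, x = 2 * t := ⟨x / 2, by ring⟩
  have ht : 0 < t := by linarith
  have h := mul_pos (Real.sinh_pos_iff.2 ht) (sub_pos.2 (Real.sinh_lt_self_mul_cosh ht))
  rw [Real.cosh_two_mul, Real.sinh_two_mul, Real.cosh_sq]
  nlinarith

theorem Real.two_mul_mul_cosh_sub_cos_lt {x : ℝ} (hx : 0 < x) (y : ℝ) :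
    2 * x * (Real.cosh x - Real.cos y) < Real.sinh x * (x ^ 2 + y ^ 2) := by
  have h₁ := mul_pos hx (sub_pos.2 (Real.two_mul_cosh_sub_one_lt_mul_sinh hx))
  have h₂ := mul_le_mul_of_nonneg_left (Real.one_sub_sq_div_two_le_cos (x := y)) hx.le
  have h₃ := mul_nonneg (sq_nonneg y) (sub_pos.2 (Real.self_lt_sinh_iff.2 hx)).le
  nlinarith

theorem re_one_div_one_sub_exp_neg_sub (w : ℂ) (hw : 1 - Complex.exp (-w) ≠ 0) :
    (1 / (1 - Complex.exp (-w)) - 1 / w - 1 / 2).re =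
      Real.sinh w.re / (2 * (Real.cosh w.re - Real.cos w.im)) -
        w.re / (w.re ^ 2 + w.im ^ 2) := by
  have hn : normSq (1 - Complex.exp (-w)) =
      2 * Real.exp (-w.re) * (Real.cosh w.re - Real.cos w.im) := by
    simp only [normSq_apply, sub_re, sub_im, one_re, one_im, exp_re, exp_im, neg_re, neg_im,
      Real.cos_neg, Real.sin_neg, Real.cosh_eq, Real.exp_neg]
    field_simp
    linear_combination Real.sin_sq_add_cos_sq w.im
  have hpos : normSq (1 - Complex.exp (-w)) ≠ 0 := normSq_eq_zero.not.2 hw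
  have hc : Real.cosh w.re - Real.cos w.im ≠ 0 := by
    rintro h
    exact hpos (by rw [hn, h, mul_zero])
  have h₁ : (1 / (1 - Complex.exp (-w))).re - 1 / 2 =
      Real.sinh w.re / (2 * (Real.cosh w.re - Real.cos w.im)) := by
    rw [one_div, inv_re, hn, sub_re, one_re, exp_re, neg_re, neg_im, Real.cos_neg, Real.exp_neg]
    field_simp
    rw [Real.cosh_eq, Real.sinh_eq, Real.exp_neg]
    field_simp
    ring
  have h₂ : (1 / w).re = w.re / (w.re ^ 2 + w.im ^ 2) := by
    rw [one_div, inv_re, normSq_apply, sq, sq]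
  have h₃ : (1 / 2 : ℂ).re = 1 / 2 := by norm_num
  rw [sub_re, sub_re, h₂, h₃, ← h₁]
  ring



/-- Lemma 5.4: for `Re w > 0` the real part of `1/(1 - e^{-w}) - 1/w - 1/2` is
strictly positive, and it vanishes on the imaginary axis (away from the
singularities, i.e. when `cos v ≠ 1`). -/
theorem re_pos_of_re_pos_and_zero_on_imaginary_axis :
    (∀ w : ℂ, 0 < w.re →
      0 < (1 / (1 - Complex.exp (-w)) - 1 / w - 1 / 2).re) ∧
    (∀ v : ℝ, Real.cos v ≠ 1 →
      (1 / (1 - Complex.exp (-(Complex.I * v))) - 1 / (Complex.I * v) - 1 / 2).re = 0) := by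
  refine ⟨fun w hw => ?_, fun v hv => ?_⟩
  · have hcosh : Real.cos w.im < Real.cosh w.re :=
      (Real.cos_le_one _).trans_lt (Real.one_lt_cosh.2 hw.ne')
    have hne : 1 - Complex.exp (-w) ≠ 0 := by
      intro h
      have h' := congrArg norm (sub_eq_zero.1 h)
      rw [norm_one, norm_exp, neg_re, eq_comm, Real.exp_eq_one_iff] at h'
      linarith
    rw [re_one_div_one_sub_exp_neg_sub w hne, sub_pos,
      div_lt_div_iff₀ (by positivity) (by linarith)]
    linarith [Real.two_mul_mul_cosh_sub_cos_lt hw w.im]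
  · rw [re_one_div_one_sub_exp_neg_sub]
    · simp
    · intro h
      have h' := congrArg re (sub_eq_zero.1 h)
      rw [one_re, exp_re] at h'
      apply hv
      simpa using h'.symm
end

section
/- For every s > 0 the series Σ_{l=1}^∞ (1/l)·arctan(s/l) converges, and the Euler–Mascheroni constant 𝒞 satisfies 𝒞 = lim_{s→∞} [ (2/π)·Σ_{l=1}^∞ (1/l)·arctan(s/l) − ln s ]. -/
open Real Filter

/-- The function `t ↦ arctan t / t`, extended by `1` at the origin. -/
noncomputable def arctanSlope : ℝ → ℝ := dslope arctan 0

/-- The inverse tangent integral `x ↦ ∫ t in 0..x, arctan t / t`. -/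
noncomputable def arctanIntegral (x : ℝ) : ℝ := ∫ t in (0 : ℝ)..x, arctanSlope t

lemma arctanSlope_zero : arctanSlope 0 = 1 := by
  simp [arctanSlope, dslope_same, Real.deriv_arctan]

lemma arctanSlope_mul_self (x : ℝ) : arctanSlope x * x = arctan x := by
  have h := sub_smul_dslope arctan 0 x
  simp only [sub_zero, smul_eq_mul, arctan_zero] at h
  rw [mul_comm]
  exact h

lemma continuous_arctanSlope : Continuous arctanSlope := by
  rw [← continuousOn_univ, arctanSlope, continuousOn_dslope univ_mem]
  exact ⟨continuous_arctan.continuousOn, differentiableAt_arctan 0⟩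

lemma concaveOn_arctan_Ici : ConcaveOn ℝ (Set.Ici 0) arctan := by
  refine AntitoneOn.concaveOn_of_deriv (convex_Ici 0) continuous_arctan.continuousOn
    differentiable_arctan.differentiableOn ?_
  rw [interior_Ici, Real.deriv_arctan]
  intro a ha b _ hab
  have ha' : (0 : ℝ) < a := ha
  dsimp only
  gcongr

lemma arctanSlope_nonneg (x : ℝ) : 0 ≤ arctanSlope x := by
  rcases lt_trichotomy x 0 with h | rfl | h
  · have h1 := arctan_lt_zero.2 h
    have h2 := arctanSlope_mul_self x
    nlinarith
  · simp [arctanSlope_zero]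
  · have h1 := arctan_pos.2 h
    have h2 := arctanSlope_mul_self x
    nlinarith

lemma antitoneOn_arctanSlope : AntitoneOn arctanSlope (Set.Ici 0) := by
  have hpos : AntitoneOn arctanSlope (Set.Ioi 0) := by
    intro a ha b hb hab
    have ha' : (0 : ℝ) < a := ha
    have hb' : (0 : ℝ) < b := hb
    have h := concaveOn_arctan_Ici.2 (Set.mem_Ici.2 hb'.le) (Set.mem_Ici.2 le_rfl)
      (div_nonneg ha'.le hb'.le) (sub_nonneg.2 ((div_le_one hb').2 hab)) (by ring)
    simp only [smul_eq_mul, mul_zero, add_zero, arctan_zero, div_mul_cancel₀ a hb'.ne'] at h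
    rw [← arctanSlope_mul_self b, ← arctanSlope_mul_self a] at h
    have h' : a / b * (arctanSlope b * b) = arctanSlope b * a := by field_simp
    rw [h'] at h
    exact le_of_mul_le_mul_right h ha'
  intro a ha b _ hab
  rcases (Set.mem_Ici.1 ha).eq_or_lt with rfl | ha'
  · rcases hab.eq_or_lt with rfl | hb'
    · exact le_rfl
    refine ge_of_tendsto (continuous_arctanSlope.continuousWithinAt (s := Set.Ioi 0)) ?_
    filter_upwards [Ioo_mem_nhdsGT hb'] with t ht using hpos ht.1 hb' ht.2.le
  · exact hpos ha' (ha'.trans_le hab) hab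

lemma arctanSlope_le_one {x : ℝ} (hx : 0 ≤ x) : arctanSlope x ≤ 1 :=
  arctanSlope_zero ▸ antitoneOn_arctanSlope (Set.mem_Ici.2 le_rfl) hx hx

lemma arctanIntegral_sub (a b : ℝ) :
    arctanIntegral b - arctanIntegral a = ∫ t in a..b, arctanSlope t :=
  intervalIntegral.integral_interval_sub_left (continuous_arctanSlope.intervalIntegrable _ _)
    (continuous_arctanSlope.intervalIntegrable _ _)

lemma continuous_arctanIntegral : Continuous arctanIntegral :=
  intervalIntegral.continuous_primitive
    (fun _ _ => continuous_arctanSlope.intervalIntegrable _ _) 0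

lemma arctanIntegral_zero : arctanIntegral 0 = 0 := by simp [arctanIntegral]

lemma arctanIntegral_nonneg {x : ℝ} (hx : 0 ≤ x) : 0 ≤ arctanIntegral x :=
  intervalIntegral.integral_nonneg hx fun t _ => arctanSlope_nonneg t

lemma arctanIntegral_sub_le {a b : ℝ} (ha : 0 ≤ a) (hab : a ≤ b) :
    arctanIntegral b - arctanIntegral a ≤ arctanSlope a * (b - a) := by
  rw [arctanIntegral_sub]
  have h := intervalIntegral.integral_mono_on hab
    (continuous_arctanSlope.intervalIntegrable a b)
    (intervalIntegrable_const (μ := MeasureTheory.volume) (c := arctanSlope a))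
    fun t ht => antitoneOn_arctanSlope ha (ha.trans ht.1) ht.1
  simpa [mul_comm] using h

lemma le_arctanIntegral_sub {a b : ℝ} (ha : 0 ≤ a) (hab : a ≤ b) :
    arctanSlope b * (b - a) ≤ arctanIntegral b - arctanIntegral a := by
  rw [arctanIntegral_sub]
  have h := intervalIntegral.integral_mono_on hab
    (intervalIntegrable_const (μ := MeasureTheory.volume) (c := arctanSlope b))
    (continuous_arctanSlope.intervalIntegrable a b)
    fun t ht => antitoneOn_arctanSlope (ha.trans ht.1) (ha.trans hab) ht.2
  simpa [mul_comm] using h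

lemma one_div_mul_arctan_div {s x : ℝ} (hx : x ≠ 0) :
    1 / x * arctan (x / s) = arctanSlope (x / s) / s := by
  rw [← arctanSlope_mul_self]
  field_simp

lemma sum_arctan_le_arctanIntegral {s : ℝ} (hs : 0 < s) (N : ℕ) :
    ∑ i ∈ Finset.range N, 1 / (i + 1 : ℝ) * arctan ((i + 1 : ℝ) / s) ≤
      arctanIntegral (N / s) := by
  induction N with
  | zero => simp [arctanIntegral_zero]
  | succ n ih =>
    rw [Finset.sum_range_succ, one_div_mul_arctan_div (by positivity)]
    push_cast
    have h := le_arctanIntegral_sub (a := n / s) (b := (n + 1) / s) (by positivity)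
      (by gcongr; linarith)
    have e : ((n : ℝ) + 1) / s - n / s = 1 / s := by ring
    rw [e, mul_one_div] at h
    linarith

lemma arctanIntegral_le_sum_arctan {s : ℝ} (hs : 0 < s) (N : ℕ) :
    arctanIntegral (N / s) - 1 / s ≤
      ∑ i ∈ Finset.range N, 1 / (i + 1 : ℝ) * arctan ((i + 1 : ℝ) / s) := by
  suffices H : arctanIntegral (N / s) + arctanSlope (N / s) / s ≤
      ∑ i ∈ Finset.range N, 1 / (i + 1 : ℝ) * arctan ((i + 1 : ℝ) / s) + 1 / s by
    have := div_nonneg (arctanSlope_nonneg (N / s)) hs.le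
    linarith
  induction N with
  | zero => simp [arctanIntegral_zero, arctanSlope_zero]
  | succ n ih =>
    rw [Finset.sum_range_succ, one_div_mul_arctan_div (by positivity)]
    push_cast
    have h := arctanIntegral_sub_le (a := n / s) (b := (n + 1) / s) (by positivity)
      (by gcongr; linarith)
    have e : ((n : ℝ) + 1) / s - n / s = 1 / s := by ring
    rw [e, mul_one_div] at h
    linarith

lemma one_div_mul_arctan_le_arctanIntegral_sub {s x : ℝ} (hs : 0 < s) (hx : 0 < x) :
    1 / (x + 1) * arctan (s / (x + 1)) ≤
      arctanIntegral (s / x) - arctanIntegral (s / (x + 1)) := by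
  have hle : s / (x + 1) ≤ s / x := by gcongr; linarith
  have h := le_arctanIntegral_sub (by positivity) hle
  have e : arctanSlope (s / x) * (s / x - s / (x + 1)) = 1 / (x + 1) * arctan (s / x) := by
    rw [← arctanSlope_mul_self]
    field_simp
    ring
  rw [e] at h
  refine le_trans ?_ h
  gcongr

lemma arctanIntegral_sub_le_one_div_mul_arctan {s x : ℝ} (hs : 0 < s) (hx : 0 < x) :
    arctanIntegral (s / x) - arctanIntegral (s / (x + 1)) ≤ 1 / x * arctan (s / x) := by
  have hle : s / (x + 1) ≤ s / x := by gcongr; linarith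
  have h := arctanIntegral_sub_le (by positivity) hle
  have e : arctanSlope (s / (x + 1)) * (s / x - s / (x + 1)) =
      1 / x * arctan (s / (x + 1)) := by
    rw [← arctanSlope_mul_self]
    field_simp
    ring
  rw [e] at h
  refine h.trans ?_
  gcongr

lemma summable_one_div_mul_arctan {s : ℝ} (hs : 0 < s) :
    Summable (fun l : ℕ => (1 / (l + 1 : ℝ)) * arctan (s / (l + 1 : ℝ))) := by
  have h2 : Summable (fun l : ℕ => s * (1 / ((l + 1 : ℕ) : ℝ) ^ 2)) :=
    ((summable_nat_add_iff 1).2 (Real.summable_one_div_nat_pow.2 one_lt_two)).mul_left s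
  refine Summable.of_nonneg_of_le (fun l => ?_) (fun l => ?_) h2
  · exact mul_nonneg (by positivity) (arctan_nonneg.2 (by positivity))
  · have hx : 0 ≤ s / (l + 1 : ℝ) := by positivity
    have h : arctan (s / (l + 1 : ℝ)) ≤ s / (l + 1 : ℝ) := by
      rw [← arctanSlope_mul_self]
      exact mul_le_of_le_one_left hx (arctanSlope_le_one hx)
    calc 1 / (l + 1 : ℝ) * arctan (s / (l + 1 : ℝ)) ≤ 1 / (l + 1 : ℝ) * (s / (l + 1 : ℝ)) := by
          gcongr
      _ = s * (1 / ((l + 1 : ℕ) : ℝ) ^ 2) := by push_cast; field_simp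

lemma tsum_arctan_le_arctanIntegral {s : ℝ} (hs : 0 < s) {N : ℕ} (hN : 0 < N) :
    ∑' i : ℕ, 1 / ((i + N : ℕ) + 1 : ℝ) * arctan (s / ((i + N : ℕ) + 1 : ℝ)) ≤
      arctanIntegral (s / N) := by
  have hN' : (0 : ℝ) < N := by exact_mod_cast hN
  refine Summable.tsum_le_of_sum_range_le
    ((summable_nat_add_iff N).2 (summable_one_div_mul_arctan hs)) fun k => ?_
  suffices H : ∑ i ∈ Finset.range k, 1 / ((i + N : ℕ) + 1 : ℝ) *
      arctan (s / ((i + N : ℕ) + 1 : ℝ)) ≤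
      arctanIntegral (s / N) - arctanIntegral (s / (k + N : ℕ)) by
    have := arctanIntegral_nonneg (x := s / (k + N : ℕ)) (by positivity)
    linarith
  induction k with
  | zero => simp
  | succ k ih =>
    rw [Finset.sum_range_succ]
    have h := one_div_mul_arctan_le_arctanIntegral_sub hs (x := (k + N : ℕ))
      (by exact_mod_cast Nat.add_pos_right k hN)
    have e : ((k + 1 + N : ℕ) : ℝ) = ((k + N : ℕ) : ℝ) + 1 := by push_cast; ring
    rw [e]
    linarith

lemma arctanIntegral_le_tsum_arctan {s : ℝ} (hs : 0 < s) (N : ℕ) :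
    arctanIntegral (s / (N + 1)) ≤
      ∑' i : ℕ, 1 / ((i + N : ℕ) + 1 : ℝ) * arctan (s / ((i + N : ℕ) + 1 : ℝ)) := by
  have hsum := ((summable_nat_add_iff N).2 (summable_one_div_mul_arctan hs)).hasSum.tendsto_sum_nat
  have hlim : Tendsto (fun k : ℕ => arctanIntegral (s / (N + 1)) -
      arctanIntegral (s / ((k + N : ℕ) + 1))) atTop (nhds (arctanIntegral (s / (N + 1)))) := by
    have h1 : Tendsto (fun k : ℕ => s / (((k + N : ℕ) : ℝ) + 1)) atTop (nhds 0) :=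
      Tendsto.div_atTop tendsto_const_nhds (tendsto_atTop_add_const_right _ _
        (tendsto_natCast_atTop_atTop.comp (tendsto_add_atTop_nat N)))
    have h2 := (continuous_arctanIntegral.tendsto 0).comp h1
    rw [arctanIntegral_zero] at h2
    simpa using tendsto_const_nhds.sub h2
  refine le_of_tendsto_of_tendsto' hlim hsum fun k => ?_
  induction k with
  | zero => simp
  | succ k ih =>
    rw [Finset.sum_range_succ]
    have h := arctanIntegral_sub_le_one_div_mul_arctan hs (x := (k + N : ℕ) + 1)
      (by positivity)
    have e : ((k + 1 + N : ℕ) : ℝ) = ((k + N : ℕ) : ℝ) + 1 := by push_cast; ring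
    rw [e]
    linarith

lemma tsum_one_div_mul_arctan_eq {s : ℝ} (hs : 0 < s) (N : ℕ) :
    ∑' l : ℕ, (1 / (l + 1 : ℝ)) * arctan (s / (l + 1 : ℝ)) =
      π / 2 * harmonic N -
        ∑ i ∈ Finset.range N, 1 / (i + 1 : ℝ) * arctan ((i + 1 : ℝ) / s) +
        ∑' i : ℕ, 1 / ((i + N : ℕ) + 1 : ℝ) * arctan (s / ((i + N : ℕ) + 1 : ℝ)) := by
  rw [← (summable_one_div_mul_arctan hs).sum_add_tsum_nat_add N]
  congr 1
  simp only [harmonic]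
  push_cast
  rw [Finset.mul_sum, ← Finset.sum_sub_distrib]
  refine Finset.sum_congr rfl fun i _ => ?_
  have h := arctan_inv_of_pos (x := ((i : ℝ) + 1) / s) (by positivity)
  rw [inv_div] at h
  rw [h]
  ring

/-- Formula (5.9): for every `s > 0` the series `∑_{l≥1} (1/l) arctan(s/l)` converges,
and the Euler–Mascheroni constant satisfies
`𝒞 = lim_{s → ∞} [(2/π) ∑_{l≥1} (1/l) arctan(s/l) - ln s]`. -/
theorem eulerMascheroni_arctan_series :
    (∀ s > (0 : ℝ),
      Summable (fun l : ℕ => (1 / (l + 1 : ℝ)) * Real.arctan (s / (l + 1 : ℝ)))) ∧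
    Tendsto
      (fun s : ℝ =>
        (2 / π) * ∑' l : ℕ, (1 / (l + 1 : ℝ)) * Real.arctan (s / (l + 1 : ℝ))
          - Real.log s)
      atTop (nhds Real.eulerMascheroniConstant) := by
  refine ⟨fun s hs => summable_one_div_mul_arctan hs, ?_⟩
  have hfloor : Tendsto (fun s : ℝ => (⌊s⌋₊ : ℝ) / s) atTop (nhds 1) :=
    tendsto_nat_floor_div_atTop
  have hinv : Tendsto (fun s : ℝ => 1 / s) atTop (nhds 0) := by
    simpa using tendsto_inv_atTop_zero (𝕜 := ℝ)
  have hsucc : Tendsto (fun s : ℝ => s / ((⌊s⌋₊ : ℝ) + 1)) atTop (nhds 1) := by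
    have h := (hfloor.add hinv).inv₀ (by norm_num)
    simp only [add_zero, inv_one] at h
    refine h.congr fun s => ?_
    rw [← add_div, inv_div]
  have hdiv : Tendsto (fun s : ℝ => s / (⌊s⌋₊ : ℝ)) atTop (nhds 1) := by
    have h := hfloor.inv₀ one_ne_zero
    simpa only [inv_one, inv_div] using h
  have hΦ := continuous_arctanIntegral.tendsto 1
  have hhead : Tendsto (fun s : ℝ => ∑ i ∈ Finset.range ⌊s⌋₊,
      1 / (i + 1 : ℝ) * arctan ((i + 1 : ℝ) / s)) atTop (nhds (arctanIntegral 1)) := by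
    have h := (hΦ.comp hfloor).sub hinv
    rw [sub_zero] at h
    refine tendsto_of_tendsto_of_tendsto_of_le_of_le' h (hΦ.comp hfloor) ?_ ?_
    · filter_upwards [eventually_gt_atTop 0] with s hs using arctanIntegral_le_sum_arctan hs _
    · filter_upwards [eventually_gt_atTop 0] with s hs using sum_arctan_le_arctanIntegral hs _
  have htail : Tendsto (fun s : ℝ => ∑' i : ℕ, 1 / ((i + ⌊s⌋₊ : ℕ) + 1 : ℝ) *
      arctan (s / ((i + ⌊s⌋₊ : ℕ) + 1 : ℝ))) atTop (nhds (arctanIntegral 1)) := by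
    refine tendsto_of_tendsto_of_tendsto_of_le_of_le' (hΦ.comp hsucc) (hΦ.comp hdiv) ?_ ?_
    · filter_upwards [eventually_gt_atTop 0] with s hs using arctanIntegral_le_tsum_arctan hs _
    · filter_upwards [eventually_ge_atTop 1] with s hs
      exact tsum_arctan_le_arctanIntegral (by linarith) (Nat.floor_pos.2 hs)
  have hlog : Tendsto (fun s : ℝ => Real.log ((⌊s⌋₊ : ℝ) / s)) atTop (nhds 0) := by
    simpa using hfloor.log one_ne_zero
  have hharm := tendsto_harmonic_sub_log.comp (tendsto_nat_floor_atTop (α := ℝ))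
  have hmain := (hharm.add hlog).add ((htail.sub hhead).const_mul (2 / π))
  simp only [sub_self, mul_zero, add_zero] at hmain
  refine hmain.congr' ?_
  filter_upwards [eventually_ge_atTop 1] with s hs
  have hs0 : 0 < s := by linarith
  have hN : (⌊s⌋₊ : ℝ) ≠ 0 := by exact_mod_cast (Nat.floor_pos.2 hs).ne'
  rw [tsum_one_div_mul_arctan_eq hs0 ⌊s⌋₊, Real.log_div hN hs0.ne', Function.comp_apply]
  have hπ : 2 / π * (π / 2) = 1 := by field_simp
  linear_combination (-(harmonic ⌊s⌋₊ : ℝ)) * hπ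
end

section
/- For every integer j ≥ 1, Σ_{n=1}^{j} c_{j,n}/n! = (j+1)(j+2)/2 = binom(j+2, 2). -/
/-- The coefficients `c_{j,n}` of (5.16): `c_{j,1} = 3/j` and
`c_{j,n+1} = ∑_{k=1}^{j-1} c_{k,1} c_{j-k,n}`. (The value for `n = 0` is junk.) -/
noncomputable def cCoeff : ℕ → ℕ → ℝ
  | _, 0 => 0
  | j, 1 => 3 / j
  | j, n + 2 => ∑ k ∈ Finset.Ico 1 j, cCoeff k 1 * cCoeff (j - k) (n + 1)

/-- The power series `∑_{k ≥ 1} 3 x^k / k = -3 log (1 - x)`. -/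
noncomputable def threeLogSeries : PowerSeries ℝ := PowerSeries.mk fun k => 3 / (k : ℝ)

namespace threeLogSeries

open PowerSeries

lemma constantCoeff_eq_zero : constantCoeff threeLogSeries = 0 := by
  rw [← coeff_zero_eq_constantCoeff_apply]
  simp [threeLogSeries]

lemma coeff_pow_of_lt {j n : ℕ} (h : j < n) : coeff j (threeLogSeries ^ n) = 0 :=
  coeff_of_lt_order _ <| lt_of_lt_of_le (by exact_mod_cast h)
    (le_order_pow_of_constantCoeff_eq_zero n constantCoeff_eq_zero)

lemma one_sub_X_mul_derivative : (1 - X) * derivative ℝ threeLogSeries = 3 := by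
  have h : derivative ℝ threeLogSeries = 3 * PowerSeries.mk 1 := by
    ext n
    have hn : (n : ℝ) + 1 ≠ 0 := by positivity
    rw [show (3 : PowerSeries ℝ) = C (3 : ℝ) from (map_ofNat C 3).symm, coeff_C_mul]
    simp [threeLogSeries, coeff_derivative, hn]
  rw [h, mul_left_comm, mul_comm (1 - X), mk_one_mul_one_sub_eq_one, mul_one]

lemma coeff_pow_recurrence (j n : ℕ) :
    (j + 1) * coeff (j + 1) (threeLogSeries ^ (n + 1))
      = j * coeff j (threeLogSeries ^ (n + 1)) + 3 * (n + 1) * coeff j (threeLogSeries ^ n) := by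
  have h : (1 - X) * derivative ℝ (threeLogSeries ^ (n + 1))
      = C (3 * (n + 1) : ℝ) * threeLogSeries ^ n := by
    rw [Derivation.leibniz_pow, Nat.add_sub_cancel, nsmul_eq_mul, smul_eq_mul]
    simp only [map_mul, map_add, map_natCast, map_one, map_ofNat]
    push_cast
    linear_combination ((n + 1 : PowerSeries ℝ) * threeLogSeries ^ n) * one_sub_X_mul_derivative
  have hj := congrArg (coeff j) h
  rw [coeff_C_mul, sub_mul, one_mul, map_sub, coeff_derivative] at hj
  cases j with
  | zero =>
    rw [coeff_zero_X_mul] at hj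
    push_cast at hj ⊢
    linarith
  | succ i =>
    rw [coeff_succ_X_mul, coeff_derivative] at hj
    push_cast at hj ⊢
    linarith

lemma sum_coeff_pow_div_factorial (j : ℕ) :
    ∑ n ∈ Finset.range (j + 1), coeff j (threeLogSeries ^ n) / (n.factorial : ℝ)
      = (j + 1) * (j + 2) / 2 := by
  induction j with
  | zero => simp
  | succ j ih =>
    have hj : (j : ℝ) + 1 ≠ 0 := by positivity
    apply mul_left_cancel₀ hj
    have hterm (n : ℕ) :
        (j + 1) * (coeff (j + 1) (threeLogSeries ^ (n + 1)) / ((n + 1).factorial : ℝ))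
          = j * (coeff j (threeLogSeries ^ (n + 1)) / ((n + 1).factorial : ℝ))
            + 3 * (coeff j (threeLogSeries ^ n) / (n.factorial : ℝ)) := by
      have hn : (n.factorial : ℝ) ≠ 0 := by positivity
      have hrec := coeff_pow_recurrence j n
      rw [Nat.factorial_succ]
      push_cast
      field_simp
      linear_combination hrec
    have hshift : (j : ℝ) * ∑ n ∈ Finset.range (j + 1),
        coeff j (threeLogSeries ^ (n + 1)) / ((n + 1).factorial : ℝ)
          = j * ((j + 1) * (j + 2) / 2) := by
      have h := Finset.sum_range_succ'
        (fun n => coeff j (threeLogSeries ^ n) / (n.factorial : ℝ)) (j + 1)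
      rw [Finset.sum_range_succ, ih, coeff_pow_of_lt (Nat.lt_succ_self j)] at h
      have h0 : (j : ℝ) * coeff j (threeLogSeries ^ 0) = 0 := by
        cases j <;> simp [coeff_one]
      simp only [Nat.factorial_zero, Nat.cast_one, div_one, zero_div, add_zero] at h
      linear_combination (-(j : ℝ)) * h - h0
    rw [Finset.sum_range_succ', mul_add, Finset.mul_sum, Finset.sum_congr rfl fun n _ => hterm n,
      Finset.sum_add_distrib, ← Finset.mul_sum, ← Finset.mul_sum, hshift, ih]
    simp only [pow_zero, coeff_one, Nat.succ_ne_zero, if_false, zero_div, mul_zero, add_zero]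
    push_cast
    ring

end threeLogSeries

lemma cCoeff_succ_eq_coeff (j n : ℕ) :
    cCoeff j (n + 1) = PowerSeries.coeff j (threeLogSeries ^ (n + 1)) := by
  induction n generalizing j with
  | zero => simp [cCoeff, threeLogSeries]
  | succ n ih =>
    rw [cCoeff, pow_succ', PowerSeries.coeff_mul,
      Finset.Nat.sum_antidiagonal_eq_sum_range_succ_mk]
    have hsub : Finset.Ico 1 j ⊆ Finset.range (j + 1) := fun k hk => by
      simp only [Finset.mem_Ico, Finset.mem_range] at hk ⊢
      omega
    refine Eq.trans (Finset.sum_congr rfl fun k _ => ?_) (Finset.sum_subset hsub fun k hk hk' => ?_)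
    · rw [ih, cCoeff]
      simp [threeLogSeries]
    · simp only [Finset.mem_Ico, Finset.mem_range] at hk hk'
      obtain rfl | rfl : k = 0 ∨ k = j := by omega
      · simp [threeLogSeries.constantCoeff_eq_zero]
      · simp [threeLogSeries.constantCoeff_eq_zero]

/-- Proposition 6.3, first part: `∑_{n=1}^j c_{j,n}/n! = (j+1)(j+2)/2 = binom(j+2,2)`. -/
theorem sum_cCoeff_div_factorial (j : ℕ) (hj : 1 ≤ j) :
    ∑ n ∈ Finset.Icc 1 j, cCoeff j n / (Nat.factorial n : ℝ)
      = ((j + 1) * (j + 2) / 2 : ℝ) ∧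
    ∑ n ∈ Finset.Icc 1 j, cCoeff j n / (Nat.factorial n : ℝ)
      = (Nat.choose (j + 2) 2 : ℝ) := by
  have hsum : ∑ n ∈ Finset.Icc 1 j, cCoeff j n / (Nat.factorial n : ℝ)
      = ((j + 1) * (j + 2) / 2 : ℝ) := by
    rw [← threeLogSeries.sum_coeff_pow_div_factorial, Finset.sum_range_succ', pow_zero,
      PowerSeries.coeff_one, if_neg (by omega), zero_div, add_zero, Finset.range_eq_Ico,
      Finset.sum_Ico_add' fun n : ℕ =>
        PowerSeries.coeff j (threeLogSeries ^ n) / (n.factorial : ℝ)]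
    refine Finset.sum_congr (by ext; simp) fun n hn => ?_
    obtain ⟨m, rfl⟩ := Nat.exists_eq_succ_of_ne_zero
      (Nat.one_le_iff_ne_zero.mp (Finset.mem_Icc.mp hn).1)
    rw [Nat.succ_eq_add_one, cCoeff_succ_eq_coeff]
  refine ⟨hsum, hsum.trans ?_⟩
  rw [Nat.cast_choose_two]
  push_cast
  ring
end

section
/- For every integer j ≥ 1, Σ_{n=1}^{j} c̃_{j,n}/n! equals (−1)^{j+1}·binom(3, j) for j ≤ 3 (i.e. the value 3 for j = 1, −3 for j = 2, 1 for j = 3) and equals 0 for every j ≥ 4. -/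
/-- The coefficients `c̃_{j,n}` of (5.16): `c̃_{j,1} = 3/j` and
`c̃_{j,n+1} = -∑_{k=1}^{j-1} c̃_{k,1} c̃_{j-k,n}`. (The value for `n = 0` is junk.) -/
noncomputable def cCoeffTilde : ℕ → ℕ → ℝ
  | _, 0 => 0
  | j, 1 => 3 / j
  | j, n + 2 => -∑ k ∈ Finset.Ico 1 j, cCoeffTilde k 1 * cCoeffTilde (j - k) (n + 1)

/-- The power series `3 log (1 - X) = -∑ (3 / j) X ^ j`. -/
noncomputable def threeLogOneSub : PowerSeries ℝ := PowerSeries.mk fun j => -(3 / (j : ℝ))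

theorem cCoeffTilde_zero_left (n : ℕ) : cCoeffTilde 0 n = 0 := by
  match n with
  | 0 => simp [cCoeffTilde]
  | 1 => simp [cCoeffTilde]
  | n + 2 => simp [cCoeffTilde]

theorem coeff_threeLogOneSub_pow_succ (n j : ℕ) :
    PowerSeries.coeff j (threeLogOneSub ^ (n + 1)) = -cCoeffTilde j (n + 1) := by
  induction n generalizing j with
  | zero => simp [threeLogOneSub, cCoeffTilde]
  | succ n ih =>
    have h (k : ℕ) : PowerSeries.coeff k threeLogOneSub = -cCoeffTilde k 1 := by
      simp [threeLogOneSub, cCoeffTilde]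
    rw [pow_succ', PowerSeries.coeff_mul]
    simp only [ih, h, neg_mul_neg]
    rw [Finset.Nat.sum_antidiagonal_eq_sum_range_succ
      (fun k l => cCoeffTilde k 1 * cCoeffTilde l (n + 1)), Finset.sum_range_succ,
      Nat.sub_self, cCoeffTilde_zero_left, mul_zero, add_zero, cCoeffTilde, neg_neg]
    rcases Nat.eq_zero_or_pos j with rfl | hj
    · simp
    · rw [Finset.range_eq_Ico, Finset.sum_eq_sum_Ico_succ_bot hj, cCoeffTilde_zero_left,
        zero_mul, zero_add]

theorem coeff_threeLogOneSub_pow_of_lt {n j : ℕ} (h : j < n) :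
    PowerSeries.coeff j (threeLogOneSub ^ n) = 0 :=
  PowerSeries.coeff_of_lt_order _ <| lt_of_lt_of_le (by exact_mod_cast h)
    (PowerSeries.le_order_pow_of_constantCoeff_eq_zero n (by simp [threeLogOneSub]))

theorem one_sub_X_mul_derivative_threeLogOneSub :
    (1 - PowerSeries.X) * PowerSeries.derivative ℝ threeLogOneSub = PowerSeries.C (-3 : ℝ) := by
  have h : PowerSeries.derivative ℝ threeLogOneSub
      = PowerSeries.C (-3 : ℝ) * PowerSeries.mk 1 := by
    ext j
    have : (j : ℝ) + 1 ≠ 0 := by positivity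
    simp [threeLogOneSub, PowerSeries.coeff_derivative]
    field_simp
  rw [h, mul_left_comm, mul_comm (1 - PowerSeries.X), PowerSeries.mk_one_mul_one_sub_eq_one,
    mul_one]

/-- The partial sums of the exponential series of `3 log (1 - X)`. -/
noncomputable def expPartialSum (N : ℕ) : PowerSeries ℝ :=
  ∑ n ∈ Finset.range (N + 1), PowerSeries.C ((n.factorial : ℝ)⁻¹) * threeLogOneSub ^ n

theorem derivative_expPartialSum_succ (N : ℕ) :
    PowerSeries.derivative ℝ (expPartialSum (N + 1))
      = expPartialSum N * PowerSeries.derivative ℝ threeLogOneSub := by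
  rw [expPartialSum, Finset.sum_range_succ', map_add, map_sum, expPartialSum, Finset.sum_mul]
  have h (n : ℕ) : PowerSeries.derivative ℝ
      (PowerSeries.C (((n + 1).factorial : ℝ)⁻¹) * threeLogOneSub ^ (n + 1))
      = PowerSeries.C ((n.factorial : ℝ)⁻¹) * threeLogOneSub ^ n
        * PowerSeries.derivative ℝ threeLogOneSub := by
    have hc : ((n.factorial : ℝ)⁻¹) = ((n + 1).factorial : ℝ)⁻¹ * ((n + 1 : ℕ) : ℝ) := by
      rw [Nat.factorial_succ]
      push_cast
      field_simp
    rw [← PowerSeries.smul_eq_C_mul, Derivation.map_smul, Derivation.leibniz_pow, hc, map_mul,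
      PowerSeries.smul_eq_C_mul, map_natCast]
    simp only [Nat.add_sub_cancel, nsmul_eq_mul, smul_eq_mul]
    ring
  simp [h]

theorem coeff_expPartialSum_succ {N j : ℕ} (h : j ≤ N) :
    PowerSeries.coeff j (expPartialSum (N + 1)) = PowerSeries.coeff j (expPartialSum N) := by
  rw [expPartialSum, Finset.sum_range_succ, ← expPartialSum, map_add, PowerSeries.coeff_C_mul,
    coeff_threeLogOneSub_pow_of_lt (by lia), mul_zero, add_zero]

theorem coeff_expPartialSum_self_succ (j : ℕ) :
    (j + 1) * PowerSeries.coeff (j + 1) (expPartialSum (j + 1))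
      = (j - 3) * PowerSeries.coeff j (expPartialSum j) := by
  have h : (1 - PowerSeries.X) * PowerSeries.derivative ℝ (expPartialSum (j + 1))
      = PowerSeries.C (-3 : ℝ) * expPartialSum j := by
    rw [derivative_expPartialSum_succ, mul_left_comm,
      one_sub_X_mul_derivative_threeLogOneSub, mul_comm]
  have h' := congrArg (PowerSeries.coeff j) h
  rw [sub_mul, one_mul, map_sub, PowerSeries.coeff_C_mul, PowerSeries.coeff_derivative] at h'
  have hX : PowerSeries.coeff j (PowerSeries.X * PowerSeries.derivative ℝ (expPartialSum (j + 1)))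
      = j * PowerSeries.coeff j (expPartialSum j) := by
    rw [← coeff_expPartialSum_succ le_rfl]
    cases j with
    | zero => simp
    | succ i =>
      rw [PowerSeries.coeff_succ_X_mul, PowerSeries.coeff_derivative]
      push_cast
      ring
  rw [hX] at h'
  linarith

theorem coeff_expPartialSum_eq_neg_sum {j : ℕ} (hj : 1 ≤ j) :
    PowerSeries.coeff j (expPartialSum j)
      = -∑ n ∈ Finset.Icc 1 j, cCoeffTilde j n / (n.factorial : ℝ) := by
  rw [expPartialSum, Finset.sum_range_succ', map_add, map_sum, ← Finset.sum_neg_distrib,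
    ← Finset.Ico_add_one_right_eq_Icc, Finset.sum_Ico_eq_sum_range]
  simp only [PowerSeries.coeff_C_mul, coeff_threeLogOneSub_pow_succ, pow_zero,
    PowerSeries.coeff_one, Nat.one_le_iff_ne_zero.mp hj, if_false, mul_zero, add_zero,
    Nat.add_sub_cancel, add_comm 1]
  exact Finset.sum_congr rfl fun n _ => by ring

theorem coeff_expPartialSum_self (j : ℕ) :
    PowerSeries.coeff j (expPartialSum j) = (-1 : ℝ) ^ j * (Nat.choose 3 j : ℝ) := by
  induction j with
  | zero => simp [expPartialSum]
  | succ j ih =>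
    have h := coeff_expPartialSum_self_succ j
    have hc : (Nat.choose 3 (j + 1) : ℝ) * (j + 1) = Nat.choose 3 j * (3 - j) := by
      rcases le_or_gt j 3 with h3 | h3
      · have := Nat.choose_succ_right_eq 3 j
        have hs : ((3 - j : ℕ) : ℝ) = 3 - j := by simp [Nat.cast_sub h3]
        rw [← hs]
        exact_mod_cast this
      · simp [Nat.choose_eq_zero_of_lt h3, Nat.choose_eq_zero_of_lt (Nat.lt_succ_of_lt h3)]
    have hj : (j : ℝ) + 1 ≠ 0 := by positivity
    apply mul_left_cancel₀ hj
    rw [h, ih, pow_succ]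
    linear_combination (-1 : ℝ) ^ j * hc

/-- Proposition 6.3, second part: `∑_{n=1}^j c̃_{j,n}/n!` equals
`(-1)^{j+1} binom(3,j)` for `j ≤ 3` and `0` for `j ≥ 4`. -/
theorem sum_cCoeffTilde_div_factorial (j : ℕ) (hj : 1 ≤ j) :
    (j ≤ 3 → ∑ n ∈ Finset.Icc 1 j, cCoeffTilde j n / (Nat.factorial n : ℝ)
        = (-1 : ℝ) ^ (j + 1) * (Nat.choose 3 j : ℝ)) ∧
    (4 ≤ j → ∑ n ∈ Finset.Icc 1 j, cCoeffTilde j n / (Nat.factorial n : ℝ) = 0) := by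
  have h : ∑ n ∈ Finset.Icc 1 j, cCoeffTilde j n / (Nat.factorial n : ℝ)
      = (-1 : ℝ) ^ (j + 1) * (Nat.choose 3 j : ℝ) := by
    have h := coeff_expPartialSum_eq_neg_sum hj
    rw [coeff_expPartialSum_self] at h
    rw [pow_succ]
    linarith
  refine ⟨fun _ => h, fun h4 => ?_⟩
  rw [h, Nat.choose_eq_zero_of_lt (by lia), Nat.cast_zero, mul_zero]
end

section
/- For every ρ > 0 and every n ≥ 1 the integral ∫₀^∞ e^{−ρt}·g^{*n}(t) dt is finite, the series Σ_{n=1}^∞ (1/n!)·∫₀^∞ e^{−ρt}·g^{*n}(t) dt converges, and exp( ∫₀^∞ e^{−ρt}·g(t) dt ) = 1 + Σ_{n=1}^∞ (1/n!)·∫₀^∞ e^{−ρt}·g^{*n}(t) dt. -/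
open Real Complex MeasureTheory

/-- The function `g` of (5.11): `g(t) = (6/t) Re(1/(1-e^{-τ}) - 1/τ - 1/2)`
with `τ = i e^{-iφ} t`. -/
noncomputable def gfun (φ t : ℝ) : ℝ :=
  (6 / t) *
    (1 / (1 - Complex.exp (-(Complex.I * Complex.exp (-Complex.I * φ) * t)))
      - 1 / (Complex.I * Complex.exp (-Complex.I * φ) * t) - 1 / 2).re

/-- Convolution powers of `g`: `g^{*1} = g`, `g^{*(n+1)}(x) = ∫₀^x g(t) g^{*n}(x-t) dt`.
(The value for `n = 0` is junk.) -/
noncomputable def gstar (φ : ℝ) : ℕ → ℝ → ℝ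
  | 0 => fun _ => 0
  | 1 => gfun φ
  | n + 2 => fun x => ∫ t in (0:ℝ)..x, gfun φ t * gstar φ (n + 1) (x - t)

/-- The function `1 / (1 - e⁻ᶻ) - 1 / z - 1 / 2` vanishes to first order at the origin. -/
lemma norm_one_div_one_sub_exp_neg_sub_le {z : ℂ} (hz0 : z ≠ 0) (hz : ‖z‖ ≤ 1) :
    ‖1 / (1 - Complex.exp (-z)) - 1 / z - 1 / 2‖ ≤ 3 * ‖z‖ := by
  have hpos : 0 < ‖z‖ := norm_pos_iff.mpr hz0
  obtain ⟨r, hr⟩ : ∃ r, r = Complex.exp (-z) - (1 - z + z ^ 2 / 2) := ⟨_, rfl⟩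
  have hrb : ‖r‖ ≤ 2 / 9 * ‖z‖ ^ 3 := by
    have h := Complex.exp_bound (x := -z) (by simpa using hz) (n := 3) (by norm_num)
    norm_num [Finset.sum_range_succ, Nat.factorial] at h
    rw [hr, sub_eq_add_neg 1 z]
    linarith
  have hE : 1 - Complex.exp (-z) = z - (z ^ 2 / 2 + r) := by rw [hr]; ring
  have hden : ‖z‖ / 4 ≤ ‖1 - Complex.exp (-z)‖ := by
    have h1 : ‖z ^ 2 / 2 + r‖ ≤ ‖z‖ ^ 2 / 2 + 2 / 9 * ‖z‖ ^ 3 := by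
      refine (norm_add_le _ _).trans (add_le_add (by simp) hrb)
    have h2 := norm_sub_norm_le z (z ^ 2 / 2 + r)
    have h3 : ‖z‖ ^ 2 ≤ ‖z‖ := by nlinarith
    have h4 : ‖z‖ ^ 3 ≤ ‖z‖ := by nlinarith
    rw [hE]
    linarith
  have hne : 1 - Complex.exp (-z) ≠ 0 := norm_pos_iff.mp (by linarith)
  have hfrac : 1 / (1 - Complex.exp (-z)) - 1 / z - 1 / 2
      = (2 * r + z ^ 3 / 2 + z * r) / (2 * z * (1 - Complex.exp (-z))) := by
    rw [div_sub_div _ _ hne hz0, div_sub_div _ _ (mul_ne_zero hne hz0) two_ne_zero,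
      div_eq_div_iff (by simp [hne, hz0]) (by simp [hne, hz0]), hE]
    ring
  have hnum : ‖2 * r + z ^ 3 / 2 + z * r‖ ≤ 3 / 2 * ‖z‖ ^ 3 := by
    have h1 : ‖2 * r + z ^ 3 / 2 + z * r‖ ≤ 2 * ‖r‖ + ‖z‖ ^ 3 / 2 + ‖z‖ * ‖r‖ := by
      refine (norm_add₃_le).trans (le_of_eq (by simp))
    have h2 : ‖z‖ * ‖r‖ ≤ ‖r‖ := mul_le_of_le_one_left (norm_nonneg _) hz
    nlinarith [pow_pos hpos 3]
  rw [hfrac, norm_div, div_le_iff₀ (norm_pos_iff.mpr (by simp [hne, hz0]))]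
  calc _ ≤ 3 / 2 * ‖z‖ ^ 3 := hnum
    _ = 3 * ‖z‖ * (2 * ‖z‖ * (‖z‖ / 4)) := by ring
    _ ≤ 3 * ‖z‖ * (2 * ‖z‖ * ‖1 - Complex.exp (-z)‖) := by gcongr
    _ = _ := by simp [mul_assoc]

lemma norm_one_div_one_sub_exp_neg_le {z : ℂ} {s : ℝ} (hs : 0 < s) (hz : s ≤ z.re) :
    ‖1 / (1 - Complex.exp (-z))‖ ≤ 1 / (1 - Real.exp (-s)) := by
  have h0 : 0 < 1 - Real.exp (-s) := by simpa using hs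
  have h1 : ‖Complex.exp (-z)‖ ≤ Real.exp (-s) := by
    rw [Complex.norm_exp]
    exact Real.exp_le_exp.mpr (by simpa using hz)
  have h2 := norm_sub_norm_le 1 (Complex.exp (-z))
  rw [norm_one] at h2
  rw [norm_div, norm_one]
  exact one_div_le_one_div_of_le h0 (by linarith)

lemma norm_I_mul_exp_neg_I_mul (φ t : ℝ) :
    ‖Complex.I * Complex.exp (-Complex.I * φ) * t‖ = |t| := by
  simp [Complex.norm_exp]

lemma re_I_mul_exp_neg_I_mul (φ t : ℝ) :
    (Complex.I * Complex.exp (-Complex.I * φ) * t).re = Real.sin φ * t := by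
  simp [Complex.exp_re, Complex.exp_im]

lemma measurable_gfun (φ : ℝ) : Measurable (gfun φ) := by
  unfold gfun
  fun_prop

lemma exists_norm_gfun_le {φ : ℝ} (hφ : 0 < Real.sin φ) :
    ∃ C, ∀ t, 0 < t → ‖gfun φ t‖ ≤ C := by
  refine ⟨max 18 (6 * (1 / (1 - Real.exp (-Real.sin φ)) + 1 + 1 / 2)), fun t ht => ?_⟩
  have hn := norm_I_mul_exp_neg_I_mul φ t
  have hre := re_I_mul_exp_neg_I_mul φ t
  rw [abs_of_pos ht] at hn
  unfold gfun
  generalize Complex.I * Complex.exp (-Complex.I * φ) * t = z at hn hre ⊢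
  rw [norm_mul, Real.norm_of_nonneg (by positivity), Real.norm_eq_abs]
  have hle := Complex.abs_re_le_norm (1 / (1 - Complex.exp (-z)) - 1 / z - 1 / 2)
  rcases le_total t 1 with h | h
  · refine le_max_of_le_left ?_
    have hb := norm_one_div_one_sub_exp_neg_sub_le (z := z)
      (norm_pos_iff.mp (hn ▸ ht)) (hn ▸ h)
    rw [hn] at hb
    calc _ ≤ 6 / t * (3 * t) := by gcongr; exact hle.trans hb
      _ = 18 := by field_simp; norm_num
  · refine le_max_of_le_right ?_
    have hb := norm_one_div_one_sub_exp_neg_le hφ (z := z) (by rw [hre]; nlinarith)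
    gcongr
    · exact div_le_self (by norm_num) h
    · refine hle.trans ((norm_sub_le _ _).trans (add_le_add ((norm_sub_le _ _).trans
        (add_le_add hb ?_)) (by norm_num)))
      rw [norm_div, norm_one, hn]
      exact (div_le_one ht).mpr h

lemma integrableOn_exp_mul_gfun {φ ρ : ℝ} (hφ : 0 < Real.sin φ) (hρ : 0 < ρ) :
    IntegrableOn (fun t => Real.exp (-(ρ * t)) * gfun φ t) (Set.Ioi 0) volume := by
  obtain ⟨C, hC⟩ := exists_norm_gfun_le hφ
  have hexp : IntegrableOn (fun t => Real.exp (-(ρ * t))) (Set.Ioi 0) volume := by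
    simpa [neg_mul] using exp_neg_integrableOn_Ioi 0 hρ
  exact Integrable.mul_bdd hexp (measurable_gfun φ).aestronglyMeasurable
    ((ae_restrict_iff' measurableSet_Ioi).mpr (.of_forall hC))

lemma exp_mul_gstar_add_two (φ ρ x : ℝ) (n : ℕ) :
    Real.exp (-(ρ * x)) * gstar φ (n + 2) x =
      ∫ t in (0 : ℝ)..x, ContinuousLinearMap.mul ℝ ℝ (Real.exp (-(ρ * t)) * gfun φ t)
        (Real.exp (-(ρ * (x - t))) * gstar φ (n + 1) (x - t)) := by
  rw [gstar, ← intervalIntegral.integral_const_mul]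
  congr 1 with t
  have h : Real.exp (-(ρ * x)) = Real.exp (-(ρ * t)) * Real.exp (-(ρ * (x - t))) := by
    rw [← Real.exp_add]
    ring_nf
  rw [h, ContinuousLinearMap.mul_apply']
  ring

/-- The Laplace transform of a convolution power is the power of the Laplace transform. -/
lemma integrableOn_and_integral_exp_mul_gstar {φ ρ : ℝ} (hφ : 0 < Real.sin φ) (hρ : 0 < ρ)
    (n : ℕ) :
    IntegrableOn (fun t => Real.exp (-(ρ * t)) * gstar φ (n + 1) t) (Set.Ioi 0) volume ∧
      ∫ t in Set.Ioi (0 : ℝ), Real.exp (-(ρ * t)) * gstar φ (n + 1) t =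
        (∫ t in Set.Ioi (0 : ℝ), Real.exp (-(ρ * t)) * gfun φ t) ^ (n + 1) := by
  have hg := integrableOn_exp_mul_gfun hφ hρ
  induction n with
  | zero => simpa [gstar] using hg
  | succ n ih =>
    simp only [exp_mul_gstar_add_two]
    constructor
    · exact (integrable_indicator_iff measurableSet_Ioi).mp (integrable_posConvolution hg ih.1 _)
    · rw [integral_posConvolution hg ih.1, ih.2, ContinuousLinearMap.mul_apply',
        pow_succ' _ (n + 1)]

/-- Formula (5.12): for `ρ > 0` each `∫₀^∞ e^{-ρt} g^{*n}(t) dt` is finite, the series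
`∑_{n≥1} (1/n!) ∫₀^∞ e^{-ρt} g^{*n}(t) dt` converges, and
`exp(∫₀^∞ e^{-ρt} g(t) dt) = 1 + ∑_{n≥1} (1/n!) ∫₀^∞ e^{-ρt} g^{*n}(t) dt`. -/
theorem exp_laplace_eq_sum_of_convolution_powers (φ : ℝ) (hφ : 0 < φ) (hφ' : φ < π / 2) :
    ∀ ρ > (0 : ℝ),
      (∀ n : ℕ, 1 ≤ n →
        IntegrableOn (fun t => Real.exp (-(ρ * t)) * gstar φ n t) (Set.Ioi 0) volume) ∧
      Summable (fun n : ℕ => (1 / (Nat.factorial (n + 1) : ℝ)) *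
        ∫ t in Set.Ioi (0 : ℝ), Real.exp (-(ρ * t)) * gstar φ (n + 1) t) ∧
      Real.exp (∫ t in Set.Ioi (0 : ℝ), Real.exp (-(ρ * t)) * gfun φ t)
        = 1 + ∑' n : ℕ, (1 / (Nat.factorial (n + 1) : ℝ)) *
            ∫ t in Set.Ioi (0 : ℝ), Real.exp (-(ρ * t)) * gstar φ (n + 1) t := by
  intro ρ hρ
  have hs : 0 < Real.sin φ := Real.sin_pos_of_pos_of_lt_pi hφ (by linarith)
  have key := integrableOn_and_integral_exp_mul_gstar hs hρ
  simp only [(key _).2]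
  set a := ∫ t in Set.Ioi (0 : ℝ), Real.exp (-(ρ * t)) * gfun φ t
  have hsum : HasSum (fun n : ℕ => (1 / (Nat.factorial n : ℝ)) * a ^ n) (Real.exp a) := by
    rw [Real.exp_eq_exp_ℝ]
    simpa [div_eq_inv_mul] using NormedSpace.expSeries_div_hasSum_exp a
  refine ⟨fun n hn => ?_, (summable_nat_add_iff 1).mpr hsum.summable, ?_⟩
  · obtain ⟨m, rfl⟩ := Nat.exists_eq_add_of_le' hn
    exact (key m).1
  · rw [← hsum.tsum_eq, hsum.summable.tsum_eq_zero_add]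
    simp
end

section
/- For every t > 0 the series ϱ(t) := Σ_{n=1}^∞ g^{*n}(t)/n! converges; the function ϱ is continuous and strictly positive on (0,∞); and ϱ(t) → (1/2)·sin φ as t → 0+. -/
open Real Complex MeasureTheory Filter

/-- The density `ϱ = ∑_{n≥1} g^{*n}/n!` of (5.13). -/
noncomputable def varrho (φ t : ℝ) : ℝ :=
  ∑' n : ℕ, gstar φ (n + 1) t / (Nat.factorial (n + 1) : ℝ)

/-- Iterated convolution powers on the half-line, `convPow G n = G^{*(n+1)}`. -/
noncomputable def convPow (G : ℝ → ℝ) : ℕ → ℝ → ℝ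
  | 0 => G
  | n + 1 => fun x => ∫ t in (0:ℝ)..x, G t * convPow G n (x - t)

lemma continuous_convPow {G : ℝ → ℝ} (hG : Continuous G) (n : ℕ) :
    Continuous (convPow G n) := by
  induction n with
  | zero => exact hG
  | succ n ih =>
    have h : Continuous (Function.uncurry fun x t : ℝ => G t * convPow G n (x - t)) := by
      unfold Function.uncurry
      fun_prop
    exact intervalIntegral.continuous_parametric_intervalIntegral_of_continuous h continuous_id

lemma convPow_pos {G : ℝ → ℝ} (hG : Continuous G) (hpos : ∀ t, 0 ≤ t → 0 < G t) (n : ℕ)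
    {x : ℝ} (hx : 0 < x) : 0 < convPow G n x := by
  induction n generalizing x with
  | zero => exact hpos x hx.le
  | succ n ih =>
    have hc := continuous_convPow hG n
    refine intervalIntegral.intervalIntegral_pos_of_pos_on
      (Continuous.intervalIntegrable (by fun_prop) _ _) (fun t ht => ?_) hx
    exact mul_pos (hpos t ht.1.le) (ih (sub_pos.2 ht.2))

lemma abs_convPow_le {G : ℝ → ℝ} {M T : ℝ} (hM : ∀ t ∈ Set.Icc 0 T, |G t| ≤ M)
    (n : ℕ) {x : ℝ} (hx : x ∈ Set.Icc 0 T) : |convPow G n x| ≤ M * (M * T) ^ n := by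
  have hM0 : 0 ≤ M := (abs_nonneg _).trans (hM x hx)
  have hT0 : 0 ≤ T := hx.1.trans hx.2
  induction n generalizing x with
  | zero => simpa [convPow] using hM x hx
  | succ n ih =>
    have hbound : ∀ t ∈ Set.uIoc 0 x, ‖G t * convPow G n (x - t)‖ ≤ M * (M * (M * T) ^ n) := by
      intro t ht
      rw [Set.uIoc_of_le hx.1] at ht
      rw [Real.norm_eq_abs, abs_mul]
      exact mul_le_mul (hM t ⟨ht.1.le, ht.2.trans hx.2⟩)
        (ih ⟨sub_nonneg.2 ht.2, by linarith [ht.1, hx.2]⟩) (abs_nonneg _) hM0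
    have h := intervalIntegral.norm_integral_le_of_norm_le_const hbound
    rw [sub_zero, abs_of_nonneg hx.1, Real.norm_eq_abs] at h
    calc |convPow G (n + 1) x| ≤ M * (M * (M * T) ^ n) * x := h
      _ ≤ M * (M * (M * T) ^ n) * T := by gcongr; exact hx.2
      _ = M * (M * T) ^ (n + 1) := by ring

/-- The series `∑ G^{*n}/n!` is dominated on `[0, T]` by an exponential series. -/
lemma exists_summable_bound_convPow {G : ℝ → ℝ} (hG : Continuous G) (T : ℝ) :
    ∃ u : ℕ → ℝ, Summable u ∧ ∀ n, ∀ x ∈ Set.Icc 0 T,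
      ‖convPow G n x / (Nat.factorial (n + 1) : ℝ)‖ ≤ u n := by
  obtain ⟨M, hM⟩ := isCompact_Icc.exists_bound_of_continuousOn (s := Set.Icc 0 T) hG.continuousOn
  refine ⟨fun n => M * ((M * T) ^ n / (Nat.factorial n : ℝ)),
    (Real.summable_pow_div_factorial (M * T)).mul_left M, fun n x hx => ?_⟩
  have hfac : (Nat.factorial n : ℝ) ≤ Nat.factorial (n + 1) := by
    exact_mod_cast Nat.factorial_le n.le_succ
  have h := abs_convPow_le hM n hx
  rw [norm_div, Real.norm_eq_abs, Real.norm_natCast]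
  refine le_of_le_of_eq ?_ (mul_div_assoc _ _ _)
  exact div_le_div₀ ((abs_nonneg _).trans h) h (by positivity) hfac

lemma summable_convPow_div_factorial {G : ℝ → ℝ} (hG : Continuous G) {t : ℝ} (ht : 0 ≤ t) :
    Summable fun n : ℕ => convPow G n t / (Nat.factorial (n + 1) : ℝ) := by
  obtain ⟨u, hu, hle⟩ := exists_summable_bound_convPow hG t
  exact hu.of_norm_bounded fun n => hle n t ⟨ht, le_rfl⟩

lemma continuousOn_tsum_convPow {G : ℝ → ℝ} (hG : Continuous G) :
    ContinuousOn (fun t => ∑' n : ℕ, convPow G n t / (Nat.factorial (n + 1) : ℝ))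
      (Set.Ici 0) := by
  intro x hx
  obtain ⟨u, hu, hle⟩ := exists_summable_bound_convPow hG (x + 1)
  have h := continuousOn_tsum (fun n => ((continuous_convPow hG n).div_const _).continuousOn) hu hle
  refine (h x ⟨hx, by linarith⟩).mono_of_mem_nhdsWithin ?_
  rw [← Set.Ici_inter_Iic]
  exact inter_mem_nhdsWithin _ (Iic_mem_nhds (by linarith))

lemma tsum_convPow_zero (G : ℝ → ℝ) :
    ∑' n : ℕ, convPow G n 0 / (Nat.factorial (n + 1) : ℝ) = G 0 := by
  rw [tsum_eq_single 0]
  · simp [convPow]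
  · intro n hn
    obtain ⟨m, rfl⟩ := Nat.exists_eq_succ_of_ne_zero hn
    simp [convPow]

lemma gstar_succ_eq_convPow {φ : ℝ} {G : ℝ → ℝ} (hG : ∀ t, 0 < t → gfun φ t = G t) (n : ℕ)
    {x : ℝ} (hx : 0 < x) : gstar φ (n + 1) x = convPow G n x := by
  induction n generalizing x with
  | zero => exact hG x hx
  | succ n ih =>
    simp only [gstar, convPow]
    rw [intervalIntegral.integral_of_le hx.le, intervalIntegral.integral_of_le hx.le,
      integral_Ioc_eq_integral_Ioo, integral_Ioc_eq_integral_Ioo]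
    refine setIntegral_congr_fun measurableSet_Ioo fun t ht => ?_
    simp only [hG t ht.1, ih (sub_pos.2 ht.2)]

lemma I_mul_exp_neg_I_mul (φ t : ℝ) :
    Complex.I * Complex.exp (-Complex.I * φ) * t =
      ((t * Real.sin φ : ℝ) : ℂ) + ((t * Real.cos φ : ℝ) : ℂ) * Complex.I := by
  rw [show -Complex.I * (φ : ℂ) = ((-φ : ℝ) : ℂ) * Complex.I by push_cast; ring,
    Complex.exp_mul_I, ← Complex.ofReal_cos, ← Complex.ofReal_sin, Real.cos_neg, Real.sin_neg]
  push_cast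
  linear_combination (-(Complex.sin φ : ℂ) * t) * Complex.I_mul_I

lemma one_sub_exp_neg_ne_zero {z : ℂ} (hz : z.re ≠ 0) : 1 - Complex.exp (-z) ≠ 0 := by
  intro h
  have h1 := congrArg norm (sub_eq_zero.1 h)
  rw [norm_one, Complex.norm_exp, Complex.neg_re, eq_comm, Real.exp_eq_one_iff] at h1
  exact hz (neg_eq_zero.1 h1)

lemma re_one_div_one_sub_exp_neg {a : ℝ} (ha : 0 < a) (b : ℝ) :
    (1 / (1 - Complex.exp (-((a : ℂ) + b * Complex.I)))).re =
      1 / 2 + Real.sinh a / (2 * (Real.cosh a - Real.cos b)) := by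
  have hre : (Complex.exp (-((a : ℂ) + b * Complex.I))).re = Real.exp (-a) * Real.cos b := by
    simp [Complex.exp_re]
  have him : (Complex.exp (-((a : ℂ) + b * Complex.I))).im = -(Real.exp (-a) * Real.sin b) := by
    simp [Complex.exp_im]
  have hD : 0 < Real.cosh a - Real.cos b := by
    linarith [Real.one_lt_cosh.2 ha.ne', Real.cos_le_one b]
  have hE : Real.exp a * Real.exp (-a) = 1 := by rw [← Real.exp_add]; simp
  have hpos := Real.exp_pos (-a)
  have hN : Complex.normSq (1 - Complex.exp (-((a : ℂ) + b * Complex.I))) =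
      2 * Real.exp (-a) * (Real.cosh a - Real.cos b) := by
    rw [Complex.normSq_apply, Complex.sub_re, Complex.sub_im, hre, him, Real.cosh_eq,
      Complex.one_re, Complex.one_im]
    linear_combination (Real.exp (-a)) ^ 2 * Real.sin_sq_add_cos_sq b - hE
  rw [one_div, Complex.inv_re, hN, Complex.sub_re, hre, Complex.one_re, div_add_div _ _ two_ne_zero
    (by positivity), div_eq_div_iff (by positivity) (by positivity), Real.cosh_eq, Real.sinh_eq]
  linear_combination (-2 * (Real.exp a + Real.exp (-a) - 2 * Real.cos b)) * hE

lemma sinh_lt_mul_cosh {x : ℝ} (hx : 0 < x) : Real.sinh x < x * Real.cosh x := by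
  have hmono : StrictMonoOn (fun y => y * Real.cosh y - Real.sinh y) (Set.Ici 0) := by
    refine strictMonoOn_of_hasDerivWithinAt_pos (f' := fun y => y * Real.sinh y)
      (convex_Ici 0) (by fun_prop) (fun y _ => ?_) fun y hy => ?_
    · refine HasDerivAt.hasDerivWithinAt ((((hasDerivAt_id y).mul
        (Real.hasDerivAt_cosh y)).sub (Real.hasDerivAt_sinh y)).congr_deriv ?_)
      simp
    · rw [interior_Ici] at hy
      exact mul_pos hy (Real.sinh_pos_iff.2 hy)
  have h := hmono Set.self_mem_Ici hx.le hx
  simpa using h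

lemma two_mul_cosh_sub_cos_lt {a : ℝ} (ha : 0 < a) (b : ℝ) :
    2 * a * (Real.cosh a - Real.cos b) < (a ^ 2 + b ^ 2) * Real.sinh a := by
  have hc := Real.one_sub_sq_div_two_le_cos (x := b)
  have hs : a < Real.sinh a := Real.self_lt_sinh_iff.2 ha
  have key : 2 * (Real.cosh a - 1) < a * Real.sinh a := by
    have hh : 0 < a / 2 := by positivity
    have h1 : Real.sinh (a / 2) < a / 2 * Real.cosh (a / 2) := sinh_lt_mul_cosh hh
    have h2 : 0 < Real.sinh (a / 2) := Real.sinh_pos_iff.2 hh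
    have h3 := Real.cosh_two_mul (a / 2)
    have h4 := Real.sinh_two_mul (a / 2)
    have h5 := Real.cosh_sq (a / 2)
    rw [mul_div_cancel₀ a two_ne_zero] at h3 h4
    nlinarith
  nlinarith [mul_le_mul_of_nonneg_left hc ha.le, mul_lt_mul_of_pos_left key ha,
    mul_nonneg (sq_nonneg b) (sub_nonneg.2 hs.le)]

lemma gfun_pos {φ t : ℝ} (hφ : 0 < Real.sin φ) (ht : 0 < t) : 0 < gfun φ t := by
  have ha : 0 < t * Real.sin φ := mul_pos ht hφ
  rw [gfun, I_mul_exp_neg_I_mul]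
  set a := t * Real.sin φ
  set b := t * Real.cos φ
  have hD : 0 < Real.cosh a - Real.cos b := by
    linarith [Real.one_lt_cosh.2 ha.ne', Real.cos_le_one b]
  have hz : (1 / ((a : ℂ) + b * Complex.I)).re = a / (a ^ 2 + b ^ 2) := by
    rw [one_div, Complex.inv_re, Complex.normSq_add_mul_I]
    simp
  have h2 : ((1 : ℂ) / 2).re = 1 / 2 := by norm_num
  rw [Complex.sub_re, Complex.sub_re, re_one_div_one_sub_exp_neg ha, hz, h2]
  have : a / (a ^ 2 + b ^ 2) < Real.sinh a / (2 * (Real.cosh a - Real.cos b)) := by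
    rw [div_lt_div_iff₀ (by positivity) (by positivity)]
    linarith [two_mul_cosh_sub_cos_lt ha b]
  exact mul_pos (by positivity) (by linarith)

/-- The Bernoulli-type expansion `1/(1 - e^{-z}) - 1/z - 1/2 ~ z/12` at the origin. -/
lemma tendsto_one_div_one_sub_exp_neg :
    Tendsto (fun z : ℂ => (1 / (1 - Complex.exp (-z)) - 1 / z - 1 / 2) / z)
      (nhdsWithin 0 {0}ᶜ) (nhds (1 / 12)) := by
  set r : ℂ → ℂ := fun z => (1 - Complex.exp (-z) - z + z ^ 2 / 2 - z ^ 3 / 6) / z ^ 3 with hr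
  have hneg : Tendsto (fun z : ℂ => -z) (nhds 0) (nhds 0) := by
    simpa using (continuous_neg (G := ℂ)).tendsto 0
  have hr0 : Tendsto r (nhdsWithin 0 {0}ᶜ) (nhds 0) := by
    have h := ((Complex.exp_sub_sum_range_succ_isLittleO_pow 3).comp_tendsto
      hneg).tendsto_div_nhds_zero.mono_left (nhdsWithin_le_nhds (s := {0}ᶜ))
    refine h.congr fun z => ?_
    simp only [Function.comp_apply, Finset.sum_range_succ, Finset.sum_range_zero, hr,
      Nat.factorial, (Odd.neg_pow (by decide) z : (-z) ^ 3 = -z ^ 3), div_neg, ← neg_div]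
    push_cast
    ring
  have hid : Tendsto (fun z : ℂ => z) (nhdsWithin 0 {0}ᶜ) (nhds 0) :=
    tendsto_id.mono_left nhdsWithin_le_nhds
  have hq : Tendsto (fun z => 1 - z / 2 + z ^ 2 / 6 + r z * z ^ 2) (nhdsWithin 0 {0}ᶜ)
      (nhds 1) := by
    simpa using ((tendsto_const_nhds.sub (hid.div_const 2)).add
      ((hid.pow 2).div_const 6)).add (hr0.mul (hid.pow 2))
  have hp : Tendsto (fun z => 1 / 12 - r z - z / 12 - r z * z / 2) (nhdsWithin 0 {0}ᶜ)
      (nhds (1 / 12)) := by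
    simpa using ((tendsto_const_nhds.sub hr0).sub (hid.div_const 12)).sub
      ((hr0.mul hid).div_const 2)
  have h := hp.div hq one_ne_zero
  rw [div_one] at h
  refine h.congr' ?_
  filter_upwards [self_mem_nhdsWithin, hq.eventually_ne one_ne_zero] with z hz hqz
  have hz : z ≠ 0 := hz
  have hrz : r z * z ^ 3 = 1 - Complex.exp (-z) - z + z ^ 2 / 2 - z ^ 3 / 6 :=
    div_mul_cancel₀ _ (pow_ne_zero 3 hz)
  have hexp : 1 - Complex.exp (-z) = z * (1 - z / 2 + z ^ 2 / 6 + r z * z ^ 2) := by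
    linear_combination -hrz
  rw [Pi.div_apply, hexp]
  set q := 1 - z / 2 + z ^ 2 / 6 + r z * z ^ 2 with hqdef
  have hnum : z ^ 2 * (1 / 12 - r z - z / 12 - r z * z / 2) = 1 - q - z * q / 2 := by
    rw [hqdef]; ring
  field_simp
  linear_combination 24 * hnum

lemma tendsto_gfun_zero (φ : ℝ) :
    Tendsto (gfun φ) (nhdsWithin 0 {0}ᶜ) (nhds ((1 / 2) * Real.sin φ)) := by
  set c : ℂ := Complex.I * Complex.exp (-Complex.I * φ) with hc
  have hc0 : c ≠ 0 := mul_ne_zero Complex.I_ne_zero (Complex.exp_ne_zero _)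
  have hcre : c.re = Real.sin φ := by
    have := I_mul_exp_neg_I_mul φ 1
    rw [Complex.ofReal_one, mul_one] at this
    rw [hc, this]
    simp [Complex.sin_ofReal_re]
  have hlim : Tendsto (fun t : ℝ => c * t) (nhdsWithin 0 {0}ᶜ) (nhdsWithin 0 {0}ᶜ) := by
    refine tendsto_nhdsWithin_iff.2 ⟨?_, ?_⟩
    · have : Continuous fun t : ℝ => c * t := by fun_prop
      simpa using (this.tendsto 0).mono_left nhdsWithin_le_nhds
    · filter_upwards [self_mem_nhdsWithin] with t ht
      exact mul_ne_zero hc0 (Complex.ofReal_ne_zero.2 ht)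
  have h := (Complex.continuous_re.tendsto _).comp
    ((tendsto_one_div_one_sub_exp_neg.comp hlim).const_mul (6 * c))
  have hval : (6 * c * (1 / 12)).re = (1 / 2) * Real.sin φ := by
    rw [← hcre, show 6 * c * (1 / 12) = ((1 / 2 : ℝ) : ℂ) * c by push_cast; ring,
      Complex.re_ofReal_mul]
  rw [hval] at h
  refine h.congr' ?_
  filter_upwards [self_mem_nhdsWithin] with t ht
  have ht' : (t : ℂ) ≠ 0 := Complex.ofReal_ne_zero.2 ht
  simp only [Function.comp_apply, gfun, ← hc]
  rw [← Complex.re_ofReal_mul]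
  congr 1
  push_cast
  field_simp

lemma continuous_update_gfun {φ : ℝ} (hφ : 0 < Real.sin φ) :
    Continuous (Function.update (gfun φ) 0 ((1 / 2) * Real.sin φ)) := by
  rw [continuous_iff_continuousAt]
  intro t
  rcases eq_or_ne t 0 with rfl | ht
  · exact continuousAt_update_same.2 (tendsto_gfun_zero φ)
  · rw [continuousAt_update_of_ne ht]
    have hre : (Complex.I * Complex.exp (-Complex.I * φ) * t).re ≠ 0 := by
      rw [I_mul_exp_neg_I_mul]
      simpa using ⟨ht, hφ.ne'⟩
    have h0 : Complex.I * Complex.exp (-Complex.I * φ) * t ≠ 0 := fun h => hre (by rw [h]; rfl)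
    have h1 := one_sub_exp_neg_ne_zero hre
    unfold gfun
    refine ContinuousAt.mul (by fun_prop (disch := exact ht)) ?_
    refine Complex.continuous_re.continuousAt.comp ?_
    fun_prop (disch := assumption)

/-- Theorem 2.6 i) (rescaled form): the series `ϱ(t) = ∑_{n≥1} g^{*n}(t)/n!` converges
for every `t > 0`, `ϱ` is continuous and strictly positive on `(0, ∞)`, and
`ϱ(t) → (1/2) sin φ` as `t → 0+`. -/
theorem varrho_continuous_positive (φ : ℝ) (hφ : 0 < φ) (hφ' : φ < π / 2) :
    (∀ t > (0 : ℝ),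
      Summable (fun n : ℕ => gstar φ (n + 1) t / (Nat.factorial (n + 1) : ℝ))) ∧
    ContinuousOn (varrho φ) (Set.Ioi 0) ∧
    (∀ t > (0 : ℝ), 0 < varrho φ t) ∧
    Tendsto (varrho φ) (nhdsWithin 0 (Set.Ioi 0)) (nhds ((1 / 2) * Real.sin φ)) := by
  have hsin : 0 < Real.sin φ := Real.sin_pos_of_pos_of_lt_pi hφ (by linarith [Real.pi_pos])
  set G : ℝ → ℝ := Function.update (gfun φ) 0 ((1 / 2) * Real.sin φ)
  have hG : Continuous G := continuous_update_gfun hsin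
  have hG0 : G 0 = (1 / 2) * Real.sin φ := Function.update_self ..
  have hGg : ∀ t, 0 < t → gfun φ t = G t := fun t ht =>
    (Function.update_of_ne ht.ne' _ _).symm
  have hGpos : ∀ t, 0 ≤ t → 0 < G t := by
    intro t ht
    rcases ht.eq_or_lt with rfl | ht
    · rw [hG0]; positivity
    · rw [← hGg t ht]; exact gfun_pos hsin ht
  have hterm : ∀ t, 0 < t → (fun n : ℕ => gstar φ (n + 1) t / (Nat.factorial (n + 1) : ℝ)) =
      fun n => convPow G n t / (Nat.factorial (n + 1) : ℝ) := fun t ht =>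
    funext fun n => by rw [gstar_succ_eq_convPow hGg n ht]
  have hrho : Set.EqOn (varrho φ)
      (fun t => ∑' n : ℕ, convPow G n t / (Nat.factorial (n + 1) : ℝ)) (Set.Ioi 0) :=
    fun t ht => by rw [varrho, hterm t ht]
  have hcont := continuousOn_tsum_convPow hG
  refine ⟨fun t ht => ?_, (hcont.mono Set.Ioi_subset_Ici_self).congr hrho, fun t ht => ?_, ?_⟩
  · rw [hterm t ht]
    exact summable_convPow_div_factorial hG (le_of_lt ht)
  · rw [hrho ht]
    have hpos : ∀ n : ℕ, 0 < convPow G n t / (Nat.factorial (n + 1) : ℝ) := fun n =>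
      div_pos (convPow_pos hG hGpos n ht) (by positivity)
    exact (summable_convPow_div_factorial hG (le_of_lt ht)).tsum_pos (fun n => (hpos n).le) 0
      (hpos 0)
  · have h := (hcont 0 Set.self_mem_Ici).mono Set.Ioi_subset_Ici_self
    rw [ContinuousWithinAt, tsum_convPow_zero, hG0] at h
    exact h.congr' (by filter_upwards [self_mem_nhdsWithin] with t ht using (hrho ht).symm)
end

section
/- The function G(z) := (3/z)·[ 1/(1 − exp(−i·e^{−iφ}·z)) + 1/(1 − exp(i·e^{iφ}·z)) − 2·sin φ / z − 1 ] is holomorphic on ℂ ∖ (𝒫 ∪ {0}), where 𝒫 := { 2πj·e^{−iφ}, 2πj·e^{iφ} : j ∈ ℤ, j ≠ 0 }; G has a removable singularity at 0 (there is a holomorphic extension of G to a neighbourhood of 0); G(t) = g(t) for every real t > 0; and for each j ∈ ℤ ∖ {0} the function z ↦ G(z) − (3i/(2πj))·(z − 2πj·e^{−iφ})⁻¹ extends holomorphically to a neighbourhood of 2πj·e^{−iφ}, while z ↦ G(z) + (3i/(2πj))·(z − 2πj·e^{iφ})⁻¹ extends holomorphically to a neighbourhood of 2πj·e^{iφ}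 (i.e. G has simple poles at 2πj·e^{∓iφ} with residues ±3i/(2πj)). -/
open Real Complex Metric

/-- The analytic continuation `G` of `g` (Section 5.5):
`G(z) = (3/z) [1/(1 - exp(-i e^{-iφ} z)) + 1/(1 - exp(i e^{iφ} z)) - 2 sin φ/z - 1]`. -/
noncomputable def Gfun (φ : ℝ) (z : ℂ) : ℂ :=
  (3 / z) *
    (1 / (1 - Complex.exp (-(Complex.I * Complex.exp (-Complex.I * φ) * z)))
      + 1 / (1 - Complex.exp (Complex.I * Complex.exp (Complex.I * φ) * z))
      - 2 * Real.sin φ / z - 1)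

/-- The set `𝒫` of poles: `2πj e^{∓iφ}`, `j ∈ ℤ ∖ {0}`. -/
noncomputable def poleSet (φ : ℝ) : Set ℂ :=
  {z | ∃ j : ℤ, j ≠ 0 ∧
    (z = 2 * π * j * Complex.exp (-Complex.I * φ) ∨
     z = 2 * π * j * Complex.exp (Complex.I * φ))}
open scoped Topology
open Filter

/-- The Laurent expansion of `1 / (1 - e^{-w})` at `0` starts with `1 / w + 1 / 2`. -/
lemma exists_analyticAt_one_div_one_sub_exp_neg :
    ∃ F : ℂ → ℂ, AnalyticAt ℂ F 0 ∧ F 0 = 1 / 2 ∧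
      ∀ᶠ w in 𝓝[≠] (0 : ℂ), 1 / (1 - Complex.exp (-w)) = 1 / w + F w := by
  let f : ℂ → ℂ := fun w => 1 - Complex.exp (-w)
  have hf : Differentiable ℂ f := by fun_prop
  have hderiv : HasDerivAt f 1 0 := by
    have h := ((Complex.hasDerivAt_exp (-0)).comp (0 : ℂ) (hasDerivAt_neg (0 : ℂ))).const_sub 1
    simpa [f, Function.comp_def] using h
  let E : ℂ → ℂ := dslope f 0
  have hE : Differentiable ℂ E := by
    rw [← differentiableOn_univ]
    exact (Complex.differentiableOn_dslope univ_mem).2 hf.differentiableOn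
  have hE0 : E 0 = 1 := by simp [E, hderiv.deriv]
  have hEinv : AnalyticAt ℂ (fun w => (E w)⁻¹) 0 :=
    (hE.analyticAt 0).inv (by simp [hE0])
  obtain ⟨s, hs, hsd⟩ := hEinv.eventually_analyticAt.exists_mem
  let F : ℂ → ℂ := dslope (fun w => (E w)⁻¹) 0
  have hF : AnalyticAt ℂ F 0 := by
    rw [Complex.analyticAt_iff_eventually_differentiableAt]
    have hd : DifferentiableOn ℂ F s := by
      refine (Complex.differentiableOn_dslope hs).2 fun w hw => ?_
      exact (hsd w hw).differentiableAt.differentiableWithinAt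
    filter_upwards [eventually_mem_nhds_iff.2 hs] with w hw
    exact hd.differentiableAt hw
  have heq : ∀ w : ℂ, w ≠ 0 → 1 / (1 - Complex.exp (-w)) = 1 / w + F w := by
    intro w hw
    have h1 : f w = w * E w := by
      have h := sub_smul_dslope f 0 w
      simpa [f, E] using h.symm
    have h2 : (E w)⁻¹ - 1 = w * F w := by
      have h := sub_smul_dslope (fun w => (E w)⁻¹) 0 w
      simpa [F, hE0] using h.symm
    change 1 / f w = _
    have h3 : F w = ((E w)⁻¹ - 1) / w := by rw [h2]; field_simp
    rw [h1, h3, one_div, mul_inv]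
    field_simp
    ring
  refine ⟨F, hF, ?_, eventually_nhdsWithin_of_forall heq⟩
  have hlim : Tendsto (fun w => F w + F (-w)) (𝓝[≠] (0 : ℂ)) (𝓝 (F 0 + F 0)) := by
    have hc : ContinuousAt (fun w => F w + F (-w)) 0 := by
      refine hF.continuousAt.add (ContinuousAt.comp' ?_ continuous_neg.continuousAt)
      simpa using hF.continuousAt
    simpa using hc.tendsto.mono_left nhdsWithin_le_nhds
  have hne : ∀ᶠ w in 𝓝[≠] (0 : ℂ), f w ≠ 0 := by
    have := hderiv.eventually_ne (c := 0) one_ne_zero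
    simpa [f] using this
  have hone : ∀ᶠ w in 𝓝[≠] (0 : ℂ), F w + F (-w) = 1 := by
    filter_upwards [hne, self_mem_nhdsWithin] with w hfw hw
    have hw : w ≠ 0 := hw
    have h1 : F w = 1 / (1 - Complex.exp (-w)) - 1 / w := by rw [heq w hw]; ring
    have h2 : F (-w) = 1 / (1 - Complex.exp w) + 1 / w := by
      have h := heq (-w) (neg_ne_zero.2 hw)
      rw [neg_neg] at h
      rw [h]; field_simp; ring
    have he : 1 - Complex.exp (-w) ≠ 0 := hfw
    have hx := Complex.exp_ne_zero w
    have he' : Complex.exp w - 1 ≠ 0 := by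
      intro h
      apply he
      rw [Complex.exp_neg, sub_eq_zero.1 h]
      simp
    have he'' : 1 - Complex.exp w ≠ 0 := by rw [← neg_sub]; exact neg_ne_zero.2 he'
    rw [h1, h2, Complex.exp_neg]
    rw [Complex.exp_neg] at he
    field_simp
    ring
  have h2 := tendsto_nhds_unique (hlim.congr' hone) tendsto_const_nhds
  linear_combination h2 / 2

lemma exists_ball_of_analyticAt {f h : ℂ → ℂ} {z₀ : ℂ} (hh : AnalyticAt ℂ h z₀)
    (heq : ∀ᶠ z in 𝓝[≠] z₀, h z = f z) :
    ∃ ε > (0 : ℝ), ∃ h : ℂ → ℂ, DifferentiableOn ℂ h (ball z₀ ε) ∧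
      ∀ z ∈ ball z₀ ε, z ≠ z₀ → h z = f z := by
  obtain ⟨ε, hε, hb⟩ := Metric.eventually_nhds_iff_ball.1
    (hh.eventually_analyticAt.and (eventually_nhdsWithin_iff.1 heq))
  exact ⟨ε, hε, h, fun z hz => (hb z hz).1.differentiableAt.differentiableWithinAt,
    fun z hz hne => (hb z hz).2 hne⟩

lemma tendsto_mul_sub_punctured_nhds {a : ℂ} (ha : a ≠ 0) (z₀ : ℂ) :
    Tendsto (fun z => a * (z - z₀)) (𝓝[≠] z₀) (𝓝[≠] (0 : ℂ)) := by
  refine tendsto_nhdsWithin_iff.2 ⟨?_, ?_⟩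
  · have hc : Continuous fun z => a * (z - z₀) := by fun_prop
    simpa using (hc.tendsto z₀).mono_left nhdsWithin_le_nhds
  · filter_upwards [self_mem_nhdsWithin] with z hz
    exact mul_ne_zero ha (sub_ne_zero.2 hz)

/-- Cancellation of the principal parts at `0`. -/
lemma exists_extension_at_zero {a b s : ℂ} (ha : a ≠ 0) (hb : b ≠ 0)
    (hs : 1 / a + 1 / b = s) :
    ∃ ε > (0 : ℝ), ∃ h : ℂ → ℂ, DifferentiableOn ℂ h (ball 0 ε) ∧
      ∀ z ∈ ball (0 : ℂ) ε, z ≠ 0 → h z = (3 / z) *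
        (1 / (1 - Complex.exp (-(a * z))) + 1 / (1 - Complex.exp (-(b * z))) - s / z - 1) := by
  obtain ⟨F, hF, hF0, hFeq⟩ := exists_analyticAt_one_div_one_sub_exp_neg
  let H : ℂ → ℂ := fun z => F (a * z) + F (b * z) - 1
  have hcomp : ∀ c : ℂ, AnalyticAt ℂ (fun z => F (c * z)) 0 := fun c =>
    AnalyticAt.fun_comp (by simpa using hF) (by fun_prop)
  have hH : AnalyticAt ℂ H 0 := ((hcomp a).add (hcomp b)).sub analyticAt_const
  have hH0 : H 0 = 0 := by simp [H, hF0]; norm_num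
  have hdH : AnalyticAt ℂ (fun z => 3 * dslope H 0 z) 0 := by
    obtain ⟨t, ht, htd⟩ := hH.eventually_analyticAt.exists_mem
    rw [Complex.analyticAt_iff_eventually_differentiableAt]
    have hd : DifferentiableOn ℂ (dslope H 0) t :=
      (Complex.differentiableOn_dslope ht).2 fun w hw =>
        (htd w hw).differentiableAt.differentiableWithinAt
    filter_upwards [eventually_mem_nhds_iff.2 ht] with w hw
    exact (hd.differentiableAt hw).const_mul 3
  refine exists_ball_of_analyticAt hdH ?_
  have ta := (tendsto_mul_sub_punctured_nhds ha 0).eventually hFeq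
  have tb := (tendsto_mul_sub_punctured_nhds hb 0).eventually hFeq
  filter_upwards [ta, tb, self_mem_nhdsWithin] with z hza hzb hz
  have hz : z ≠ 0 := hz
  simp only [sub_zero] at hza hzb
  have h := sub_smul_dslope H 0 z
  simp only [sub_zero, hH0, smul_eq_mul] at h
  have h' : dslope H 0 z = H z / z := by rw [← h]; field_simp
  rw [hza, hzb, h', ← hs]
  simp only [H]
  field_simp
  ring

/-- Subtraction of the principal part at a simple pole coming from the first exponential. -/
lemma exists_extension_at_pole {a b s z₀ : ℂ} {n : ℤ} (ha : a ≠ 0) (hz₀ : z₀ ≠ 0)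
    (hn : a * z₀ = n * (2 * π * Complex.I)) (hb : Complex.exp (-(b * z₀)) ≠ 1) :
    ∃ ε > (0 : ℝ), ∃ h : ℂ → ℂ, DifferentiableOn ℂ h (ball z₀ ε) ∧
      ∀ z ∈ ball z₀ ε, z ≠ z₀ → h z = (3 / z) *
        (1 / (1 - Complex.exp (-(a * z))) + 1 / (1 - Complex.exp (-(b * z))) - s / z - 1)
          - 3 / (a * z₀) * (z - z₀)⁻¹ := by
  obtain ⟨F, hF, -, hFeq⟩ := exists_analyticAt_one_div_one_sub_exp_neg
  have hcomp : AnalyticAt ℂ (fun z => F (a * (z - z₀))) z₀ :=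
    AnalyticAt.fun_comp (by simpa using hF) (by fun_prop)
  have hden : 1 - Complex.exp (-(b * z₀)) ≠ 0 := sub_ne_zero.2 hb.symm
  have hH : AnalyticAt ℂ (fun z => (3 / z) * (F (a * (z - z₀)) +
      1 / (1 - Complex.exp (-(b * z))) - s / z - 1) - 3 / (a * z₀) / z) z₀ := by
    have hexp : AnalyticAt ℂ (fun z => 1 - Complex.exp (-(b * z))) z₀ := by
      have hd : Differentiable ℂ fun z => 1 - Complex.exp (-(b * z)) := by fun_prop
      exact hd.analyticAt z₀
    have hdiv (c : ℂ) : AnalyticAt ℂ (fun z => c / z) z₀ :=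
      analyticAt_const.div analyticAt_id hz₀
    exact ((hdiv 3).mul (((hcomp.add (analyticAt_const.div hexp hden)).sub (hdiv s)).sub
      analyticAt_const)).sub (hdiv _)
  refine exists_ball_of_analyticAt hH ?_
  filter_upwards [(tendsto_mul_sub_punctured_nhds ha z₀).eventually hFeq, self_mem_nhdsWithin,
    nhdsWithin_le_nhds (eventually_ne_nhds hz₀)] with z hza hz hz0
  have hsub : z - z₀ ≠ 0 := sub_ne_zero.2 hz
  have hper : Complex.exp (-(a * z)) = Complex.exp (-(a * (z - z₀))) := by
    rw [Complex.exp_eq_exp_iff_exists_int]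
    exact ⟨-n, by push_cast; linear_combination -hn⟩
  rw [hper, hza]
  field_simp
  ring

lemma Gfun_eq (φ : ℝ) (z : ℂ) : Gfun φ z = (3 / z) *
    (1 / (1 - Complex.exp (-((Complex.I * Complex.exp (-Complex.I * φ)) * z)))
      + 1 / (1 - Complex.exp (-((-Complex.I * Complex.exp (Complex.I * φ)) * z)))
      - (2 * Real.sin φ : ℂ) / z - 1) := by
  simp only [Gfun, neg_mul, neg_neg]

lemma exp_neg_I_mul_mul_exp_I_mul (φ : ℝ) :
    Complex.exp (-Complex.I * φ) * Complex.exp (Complex.I * φ) = 1 := by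
  rw [← Complex.exp_add]; simp

lemma ofReal_sin_eq (φ : ℝ) : (2 * Real.sin φ : ℂ) =
    (Complex.exp (-Complex.I * φ) - Complex.exp (Complex.I * φ)) * Complex.I := by
  rw [Complex.ofReal_sin, Complex.two_sin]
  ring_nf

lemma int_mul_exp_ne {φ : ℝ} (hφ : 0 < φ) (hφ' : φ < π / 2) {j k : ℤ} (hj : j ≠ 0) :
    (j : ℂ) * Complex.exp (Complex.I * φ) ≠ k * Complex.exp (-Complex.I * φ) := by
  intro h
  have hs : 0 < Real.sin φ := Real.sin_pos_of_pos_of_lt_pi hφ (by linarith)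
  have hc : 0 < Real.cos φ := Real.cos_pos_of_mem_Ioo ⟨by linarith, hφ'⟩
  have h1 : Complex.exp (Complex.I * φ) = Real.cos φ + Real.sin φ * Complex.I := by
    rw [mul_comm, Complex.exp_mul_I]; simp
  have h2 : Complex.exp (-Complex.I * φ) = Real.cos φ - Real.sin φ * Complex.I := by
    rw [show -Complex.I * φ = (-φ : ℂ) * Complex.I by ring, Complex.exp_mul_I]; simp; ring
  rw [h1, h2] at h
  have hre := congrArg Complex.re h
  have him := congrArg Complex.im h
  simp [-Complex.ofReal_cos, -Complex.ofReal_sin] at hre him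
  rcases hre with hre | hre
  · have : (j : ℝ) * Real.sin φ = 0 := by
      have hk : (j : ℝ) = k := by exact_mod_cast hre
      rw [← hk] at him
      linarith
    rcases mul_eq_zero.1 this with h | h
    · exact hj (by exact_mod_cast h)
    · exact hs.ne' h
  · exact hc.ne' hre

lemma Gfun_ofReal (φ t : ℝ) : Gfun φ t = (gfun φ t : ℂ) := by
  have hconj : (starRingEnd ℂ) (Complex.exp (-(Complex.I * Complex.exp (-Complex.I * φ) * t)))
      = Complex.exp (Complex.I * Complex.exp (Complex.I * φ) * t) := by
    simp [← Complex.exp_conj]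
  have hconj' : (starRingEnd ℂ) (Complex.exp (-Complex.I * φ)) = Complex.exp (Complex.I * φ) := by
    simp [← Complex.exp_conj]
  have hmul := exp_neg_I_mul_mul_exp_I_mul φ
  have hy := Complex.exp_ne_zero (Complex.I * φ)
  rw [gfun, Gfun, Complex.ofReal_mul, Complex.re_eq_add_conj]
  simp only [map_sub, map_div₀, map_one, map_mul, hconj, hconj', Complex.conj_I,
    Complex.conj_ofReal, map_ofNat]
  rw [ofReal_sin_eq]
  have hinv : 1 / (Complex.I * Complex.exp (-Complex.I * φ) * t)
      + 1 / (-Complex.I * Complex.exp (Complex.I * φ) * t)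
      = (Complex.exp (-Complex.I * φ) - Complex.exp (Complex.I * φ)) * Complex.I / t := by
    rw [eq_inv_of_mul_eq_one_left hmul]
    have hI := Complex.I_sq
    rcases eq_or_ne (t : ℂ) 0 with ht | ht
    · simp [ht]
    · field_simp
      linear_combination (Complex.exp (Complex.I * φ) ^ 2 - 1) * hI
  rw [← hinv]
  push_cast
  ring

lemma differentiableOn_Gfun (φ : ℝ) : DifferentiableOn ℂ (Gfun φ) (poleSet φ ∪ {0})ᶜ := by
  intro z hz
  simp only [Set.mem_compl_iff, Set.mem_union, Set.mem_singleton_iff, not_or] at hz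
  obtain ⟨hP, hz0⟩ := hz
  have hmul := exp_neg_I_mul_mul_exp_I_mul φ
  have h1 : 1 - Complex.exp (-(Complex.I * Complex.exp (-Complex.I * φ) * z)) ≠ 0 := by
    intro h
    obtain ⟨n, hn⟩ := Complex.exp_eq_one_iff.1 (sub_eq_zero.1 h).symm
    have hzn : z = 2 * π * (-n : ℤ) * Complex.exp (Complex.I * φ) := by
      have h3 : Complex.exp (-Complex.I * φ) * z = 2 * π * (-n : ℤ) :=
        mul_left_cancel₀ Complex.I_ne_zero (by push_cast; linear_combination -hn)
      linear_combination Complex.exp (Complex.I * φ) * h3 - z * hmul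
    refine hP ⟨-n, fun h0 => hz0 ?_, Or.inr hzn⟩
    rw [hzn, h0]; simp
  have h2 : 1 - Complex.exp (Complex.I * Complex.exp (Complex.I * φ) * z) ≠ 0 := by
    intro h
    obtain ⟨n, hn⟩ := Complex.exp_eq_one_iff.1 (sub_eq_zero.1 h).symm
    have hzn : z = 2 * π * n * Complex.exp (-Complex.I * φ) := by
      have h3 : Complex.exp (Complex.I * φ) * z = 2 * π * n :=
        mul_left_cancel₀ Complex.I_ne_zero (by linear_combination hn)
      linear_combination Complex.exp (-Complex.I * φ) * h3 - z * hmul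
    refine hP ⟨n, fun h0 => hz0 ?_, Or.inl hzn⟩
    rw [hzn, h0]; simp
  refine DifferentiableAt.differentiableWithinAt ?_
  unfold Gfun
  fun_prop (disch := assumption)

/-- Lemma 5.6: `G` is holomorphic on `ℂ ∖ (𝒫 ∪ {0})`, has a removable singularity at `0`,
agrees with `g` on `(0,∞)`, and has simple poles at `2πj e^{∓iφ}` with residues
`±3i/(2πj)` for `j ∈ ℤ ∖ {0}`. -/
theorem Gfun_meromorphic_structure (φ : ℝ) (hφ : 0 < φ) (hφ' : φ < π / 2) :
    DifferentiableOn ℂ (Gfun φ) (poleSet φ ∪ {0})ᶜ ∧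
    (∃ ε > (0 : ℝ), ∃ h : ℂ → ℂ, DifferentiableOn ℂ h (ball 0 ε) ∧
      ∀ z ∈ ball (0 : ℂ) ε, z ≠ 0 → h z = Gfun φ z) ∧
    (∀ t : ℝ, 0 < t → Gfun φ t = (gfun φ t : ℂ)) ∧
    (∀ j : ℤ, j ≠ 0 →
      (∃ ε > (0 : ℝ), ∃ h : ℂ → ℂ,
        DifferentiableOn ℂ h (ball (2 * π * j * Complex.exp (-Complex.I * φ)) ε) ∧
        ∀ z ∈ ball (2 * π * j * Complex.exp (-Complex.I * φ) : ℂ) ε,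
          z ≠ 2 * π * j * Complex.exp (-Complex.I * φ) →
            h z = Gfun φ z - (3 * Complex.I / (2 * π * j)) *
              (z - 2 * π * j * Complex.exp (-Complex.I * φ))⁻¹) ∧
      (∃ ε > (0 : ℝ), ∃ h : ℂ → ℂ,
        DifferentiableOn ℂ h (ball (2 * π * j * Complex.exp (Complex.I * φ)) ε) ∧
        ∀ z ∈ ball (2 * π * j * Complex.exp (Complex.I * φ) : ℂ) ε,
          z ≠ 2 * π * j * Complex.exp (Complex.I * φ) →
            h z = Gfun φ z + (3 * Complex.I / (2 * π * j)) *
              (z - 2 * π * j * Complex.exp (Complex.I * φ))⁻¹)) := by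
  have hmul := exp_neg_I_mul_mul_exp_I_mul φ
  have hx := Complex.exp_ne_zero (-Complex.I * φ)
  have hy := Complex.exp_ne_zero (Complex.I * φ)
  have hI := Complex.I_ne_zero
  have hπ : (π : ℂ) ≠ 0 := by exact_mod_cast Real.pi_ne_zero
  have ha : Complex.I * Complex.exp (-Complex.I * φ) ≠ 0 := mul_ne_zero hI hx
  have hb : -Complex.I * Complex.exp (Complex.I * φ) ≠ 0 := mul_ne_zero (neg_ne_zero.2 hI) hy
  refine ⟨differentiableOn_Gfun φ, ?_, fun t _ => Gfun_ofReal φ t, fun j hj => ⟨?_, ?_⟩⟩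
  · simp only [Gfun_eq]
    refine exists_extension_at_zero ha hb ?_
    rw [ofReal_sin_eq, eq_inv_of_mul_eq_one_left hmul]
    field_simp
    linear_combination (Complex.exp (Complex.I * φ) ^ 2 - 1) * Complex.I_sq
  · have hj' : (j : ℂ) ≠ 0 := by exact_mod_cast hj
    have hz : (2 * π * j * Complex.exp (-Complex.I * φ) : ℂ) ≠ 0 := by simp [hπ, hj']
    have haz : -Complex.I * Complex.exp (Complex.I * φ) *
        (2 * π * j * Complex.exp (-Complex.I * φ)) = (-j : ℤ) * (2 * π * Complex.I) := by
      push_cast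
      linear_combination (-(2 * π * j * Complex.I)) * hmul
    obtain ⟨ε, hε, h, hd, heq⟩ := exists_extension_at_pole (s := 2 * Real.sin φ)
      (b := Complex.I * Complex.exp (-Complex.I * φ)) hb hz haz (by
        intro h
        obtain ⟨n, hn⟩ := Complex.exp_eq_one_iff.1 h
        have h3 : Complex.exp (-Complex.I * φ) * (j * Complex.exp (-Complex.I * φ)) = (-n : ℤ) :=
          mul_left_cancel₀ Complex.two_pi_I_ne_zero (by push_cast; linear_combination -hn)
        refine int_mul_exp_ne hφ hφ' (j := -n) (k := j) (fun h0 => ?_) ?_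
        · rw [h0] at h3
          simp [hj'] at h3
        · rw [← h3]
          linear_combination (j * Complex.exp (-Complex.I * φ)) * hmul)
    refine ⟨ε, hε, h, hd, fun z hz hne => ?_⟩
    have hres : 3 * Complex.I / (2 * π * j) = 3 / (((-j : ℤ) : ℂ) * (2 * π * Complex.I)) := by
      push_cast
      field_simp
      simp
    rw [heq z hz hne, Gfun_eq, haz, hres]
    ring
  · have hj' : (j : ℂ) ≠ 0 := by exact_mod_cast hj
    have hz : (2 * π * j * Complex.exp (Complex.I * φ) : ℂ) ≠ 0 := by simp [hπ, hj']
    have haz : Complex.I * Complex.exp (-Complex.I * φ) *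
        (2 * π * j * Complex.exp (Complex.I * φ)) = j * (2 * π * Complex.I) := by
      linear_combination (2 * π * j * Complex.I) * hmul
    obtain ⟨ε, hε, h, hd, heq⟩ := exists_extension_at_pole (s := 2 * Real.sin φ)
      (b := -Complex.I * Complex.exp (Complex.I * φ)) ha hz haz (by
        intro h
        obtain ⟨n, hn⟩ := Complex.exp_eq_one_iff.1 h
        have h3 : Complex.exp (Complex.I * φ) * (j * Complex.exp (Complex.I * φ)) = n :=
          mul_left_cancel₀ Complex.two_pi_I_ne_zero (by linear_combination hn)
        refine int_mul_exp_ne hφ hφ' (j := j) (k := n) hj ?_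
        rw [← h3]
        linear_combination (-(j * Complex.exp (Complex.I * φ))) * hmul)
    refine ⟨ε, hε, h, hd, fun z hz hne => ?_⟩
    have hres : 3 * Complex.I / (2 * π * j) = -(3 / ((j : ℂ) * (2 * π * Complex.I))) := by
      field_simp
      simp
    rw [heq z hz hne, Gfun_eq, haz, hres]
    ring
end

section
/- Let t₀ > 0 and let U ⊂ ℂ be the open disc centered at t₀ with radius r, 0 < r < t₀. Then the following are equivalent: (i) there exists a function F holomorphic on U with F(z) = f(z) for all z ∈ U with Im z > 0; (ii) there exists a function Φ holomorphic on U which is real-valued on U ∩ ℝ such that μ restricted to the interval (t₀ − r, t₀ + r) is absolutely continuous with respect to Lebesgue measure with density Φ|_{U∩ℝ}, i.e. μ(A) = ∫_A Φ(x) dx for every Borel set A ⊆ (t₀ − r, t₀ + r). -/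
open MeasureTheory Metric Set

/-- The Stieltjes transform of a finite Borel measure `μ` on `[0, ∞)`:
`f(z) = ∫ (s - z)⁻¹ dμ(s)`. -/
noncomputable def stieltjes (μ : Measure ℝ) (z : ℂ) : ℂ :=
  ∫ s, ((s : ℂ) - z)⁻¹ ∂μ

open Filter Topology
open scoped Real Interval ComplexConjugate

/-- A parametric integral of holomorphic functions with a locally uniform integrable bound is
holomorphic. -/
theorem differentiableOn_integral_of_locally_dominated {α : Type*} [MeasurableSpace α]
    {ν : Measure α} {U : Set ℂ} (hU : IsOpen U) {g : ℂ → α → ℂ}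
    (hmeas : ∀ z ∈ U, AEStronglyMeasurable (g z) ν)
    (hdiff : ∀ᵐ a ∂ν, DifferentiableOn ℂ (fun z => g z a) U)
    (hbound : ∀ z₀ ∈ U, ∃ ε > 0, ∃ bound : α → ℝ, Integrable bound ν ∧
      ∀ᵐ a ∂ν, ∀ z ∈ ball z₀ ε, ‖g z a‖ ≤ bound a) :
    DifferentiableOn ℂ (fun z => ∫ a, g z a ∂ν) U := by
  intro z₀ hz₀
  obtain ⟨ε₁, hε₁, bound, hbi, hb⟩ := hbound z₀ hz₀
  obtain ⟨ε₂, hε₂, hball⟩ := Metric.isOpen_iff.1 hU z₀ hz₀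
  obtain ⟨ε, hε, hε1, hε2⟩ : ∃ ε > 0, ε ≤ ε₁ ∧ ε ≤ ε₂ :=
    ⟨min ε₁ ε₂, lt_min hε₁ hε₂, min_le_left _ _, min_le_right _ _⟩
  have hsub : ball z₀ ε ⊆ U := (ball_subset_ball hε2).trans hball
  have hderiv : ∀ᵐ a ∂ν, ∀ z ∈ U, HasDerivAt (g · a) (deriv (g · a) z) z := by
    filter_upwards [hdiff] with a ha z hz
    exact (ha.differentiableAt (hU.mem_nhds hz)).hasDerivAt
  have hcauchy : ∀ᵐ a ∂ν, ∀ z ∈ ball z₀ (ε / 2), ‖deriv (g · a) z‖ ≤ bound a / (ε / 4) := by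
    filter_upwards [hb, hdiff] with a ha hd z hz
    have hcl : closedBall z (ε / 4) ⊆ ball z₀ ε := by
      intro w hw
      rw [mem_ball] at hz ⊢
      rw [mem_closedBall] at hw
      linarith [dist_triangle w z z₀]
    refine Complex.norm_deriv_le_of_forall_mem_sphere_norm_le (by linarith) ?_ ?_
    · refine DifferentiableOn.diffContOnCl (hd.mono ?_)
      rw [closure_ball _ (by linarith : ε / 4 ≠ 0)]
      exact hcl.trans hsub
    · exact fun w hw => ha w (ball_subset_ball hε1 (hcl (sphere_subset_closedBall hw)))
  have hF' : AEStronglyMeasurable (fun a => deriv (g · a) z₀) ν := by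
    have hlim : Tendsto (fun n : ℕ => z₀ + ((ε / 2 / (n + 1) : ℝ) : ℂ)) atTop (𝓝[≠] z₀) := by
      refine tendsto_nhdsWithin_iff.2 ⟨?_, Eventually.of_forall fun n => ?_⟩
      · have h0 : Tendsto (fun n : ℕ => ε / 2 / (n + 1 : ℝ)) atTop (𝓝 0) :=
          tendsto_const_nhds.div_atTop (tendsto_natCast_atTop_atTop.atTop_add tendsto_const_nhds)
        have := ((Complex.continuous_ofReal.tendsto 0).comp h0).const_add z₀
        simpa using this
      · have : (0 : ℝ) < ε / 2 / (n + 1) := by positivity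
        simp only [mem_compl_iff, mem_singleton_iff, add_eq_left, Complex.ofReal_eq_zero]
        exact this.ne'
    refine aestronglyMeasurable_of_tendsto_ae atTop
      (f := fun (n : ℕ) a => slope (g · a) z₀ (z₀ + ((ε / 2 / (n + 1) : ℝ) : ℂ))) (fun n => ?_) ?_
    · have hmem : z₀ + ((ε / 2 / (n + 1) : ℝ) : ℂ) ∈ U := by
        apply hsub
        have h1 : ε / 2 / (n + 1) ≤ ε / 2 :=
          div_le_self (by positivity) (by linarith [n.cast_nonneg (α := ℝ)])
        have h2 : (0 : ℝ) ≤ ε / 2 / (n + 1) := by positivity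
        rw [mem_ball, dist_eq_norm, add_sub_cancel_left, Complex.norm_real, Real.norm_of_nonneg h2]
        linarith
      simp only [slope, vsub_eq_sub, smul_eq_mul]
      exact ((hmeas _ hmem).sub (hmeas _ hz₀)).const_mul _
    · filter_upwards [hderiv] with a ha
      exact (hasDerivAt_iff_tendsto_slope.1 (ha z₀ hz₀)).comp hlim
  have hint : Integrable (g z₀) ν := by
    refine hbi.mono' (hmeas _ hz₀) ?_
    filter_upwards [hb] with a ha using ha _ (mem_ball_self hε₁)
  exact (hasDerivAt_integral_of_dominated_loc_of_deriv_le (ball_mem_nhds z₀ (half_pos hε))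
    (by filter_upwards [hU.mem_nhds hz₀] with z hz using hmeas z hz) hint hF' hcauchy
    (hbi.div_const _) (by
      filter_upwards [hderiv] with a ha z hz
      exact ha z (hsub (ball_subset_ball (by linarith) hz)))).2.differentiableAt.differentiableWithinAt

theorem ofReal_mem_ball_iff {x t r : ℝ} :
    (x : ℂ) ∈ ball (t : ℂ) r ↔ x ∈ Ioo (t - r) (t + r) := by
  rw [← Real.ball_eq_Ioo, mem_ball, mem_ball, Complex.dist_eq, ← Complex.ofReal_sub,
    Complex.norm_real, Real.dist_eq, Real.norm_eq_abs]

theorem restrict_Ioo_eq_of_forall_restrict_Ioc_eq {μ ν : Measure ℝ} {a b : ℝ} (hab : a < b)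
    (h : ∀ c d, a < c → c < d → d < b → μ.restrict (Ioc c d) = ν.restrict (Ioc c d)) :
    μ.restrict (Ioo a b) = ν.restrict (Ioo a b) := by
  have hU : Ioo a b = ⋃ n : ℕ,
      Ioc (a + (b - a) / (n + 3)) (b - (b - a) / (n + 3)) := by
    ext x
    simp only [mem_Ioo, mem_iUnion, mem_Ioc]
    constructor
    · rintro ⟨h1, h2⟩
      have h0 : Tendsto (fun n : ℕ => (b - a) / (n + 3 : ℝ)) atTop (𝓝 0) :=
        tendsto_const_nhds.div_atTop (tendsto_natCast_atTop_atTop.atTop_add tendsto_const_nhds)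
      have hpos : 0 < min (x - a) (b - x) := lt_min (by linarith) (by linarith)
      obtain ⟨n, hn⟩ := (h0.eventually_lt_const hpos).exists
      refine ⟨n, ?_, ?_⟩ <;> linarith [min_le_left (x - a) (b - x), min_le_right (x - a) (b - x)]
    · rintro ⟨n, h1, h2⟩
      have : 0 < (b - a) / (n + 3 : ℝ) := div_pos (by linarith) (by positivity)
      constructor <;> linarith
  rw [hU, Measure.restrict_iUnion_congr]
  intro n
  have h1 : 0 < (b - a) / (n + 3 : ℝ) := div_pos (by linarith) (by positivity)
  have h2 : (b - a) / (n + 3 : ℝ) ≤ (b - a) / 3 :=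
    div_le_div_of_nonneg_left (by linarith) (by norm_num) (by linarith [n.cast_nonneg (α := ℝ)])
  exact h _ _ (by linarith) (by linarith) (by linarith)

theorem restrict_eq_withDensity_of_measureReal_Ioc_eq {μ : Measure ℝ} [IsFiniteMeasure μ]
    {a b : ℝ} (hab : a < b) {h : ℝ → ℝ} (hc : ContinuousOn h (Ioo a b))
    (h0 : ∀ x ∈ Ioo a b, 0 ≤ h x)
    (hI : ∀ c d, a < c → c < d → d < b → μ.real (Ioc c d) = ∫ x in c..d, h x) :
    μ.restrict (Ioo a b) =
      (volume.restrict (Ioo a b)).withDensity fun x => ENNReal.ofReal (h x) := by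
  rw [← restrict_withDensity measurableSet_Ioo]
  refine restrict_Ioo_eq_of_forall_restrict_Ioc_eq hab fun c d hac hcd hdb => ?_
  have key : ∀ c' d', c ≤ c' → d' ≤ d → μ (Ioc c' d') =
      volume.withDensity (fun x => ENNReal.ofReal (h x)) (Ioc c' d') := by
    intro c' d' hc' hd'
    rcases le_or_gt d' c' with hle | hlt
    · simp [Ioc_eq_empty (not_lt.2 hle)]
    have hsub : Icc c' d' ⊆ Ioo a b := fun x hx =>
      ⟨by linarith [hx.1], by linarith [hx.2]⟩
    rw [withDensity_apply _ measurableSet_Ioc, ← ofReal_integral_eq_lintegral_ofReal,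
      ← intervalIntegral.integral_of_le hlt.le, ← hI c' d' (by linarith) hlt (by linarith),
      ofReal_measureReal]
    · exact ((hc.mono hsub).integrableOn_Icc).mono_set Ioc_subset_Icc_self
    · refine (ae_restrict_iff' measurableSet_Ioc).2 (ae_of_all _ fun x hx => ?_)
      exact h0 x (hsub (Ioc_subset_Icc_self hx))
  refine Measure.ext_of_Ioc_finite _ _ ?_ fun p q _ => ?_
  · simpa using key c d le_rfl le_rfl
  · rw [Measure.restrict_apply measurableSet_Ioc, Measure.restrict_apply measurableSet_Ioc,
      Ioc_inter_Ioc]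
    exact key _ _ (le_max_right _ _) (min_le_right _ _)

theorem integrable_stieltjes_kernel (μ : Measure ℝ) [IsFiniteMeasure μ] {z : ℂ} (hz : z.im ≠ 0) :
    Integrable (fun s : ℝ => ((s : ℂ) - z)⁻¹) μ := by
  have hne : ∀ s : ℝ, (s : ℂ) - z ≠ 0 := fun s h => hz (by simpa using congrArg Complex.im h)
  refine Integrable.of_bound (C := |z.im|⁻¹) ?_ (ae_of_all _ fun s => ?_)
  · exact (Continuous.inv₀ (by fun_prop) hne).aestronglyMeasurable
  · rw [norm_inv]
    refine inv_anti₀ (abs_pos.2 hz) ?_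
    simpa using Complex.abs_im_le_norm ((s : ℂ) - z)

theorem stieltjes_im (μ : Measure ℝ) [IsFiniteMeasure μ] (x : ℝ) {ε : ℝ} (hε : 0 < ε) :
    (stieltjes μ (x + ε * Complex.I)).im = ∫ s, ε / ((s - x) ^ 2 + ε ^ 2) ∂μ := by
  have hz : ((x : ℂ) + ε * Complex.I).im ≠ 0 := by simpa using hε.ne'
  have := Complex.imCLM.integral_comp_comm (integrable_stieltjes_kernel μ hz)
  simp only [Complex.imCLM_apply] at this
  rw [stieltjes, ← this]
  refine integral_congr_ae (ae_of_all _ fun s => ?_)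
  simp [Complex.inv_im, Complex.normSq_apply, pow_two]

theorem intervalIntegral_poisson (s c d : ℝ) {ε : ℝ} (hε : 0 < ε) :
    ∫ x in c..d, ε / ((s - x) ^ 2 + ε ^ 2) =
      Real.arctan ((d - s) / ε) - Real.arctan ((c - s) / ε) := by
  refine intervalIntegral.integral_eq_sub_of_hasDerivAt
    (f := fun x => Real.arctan ((x - s) / ε)) (fun x _ => ?_) ?_
  · refine (((hasDerivAt_id' x).sub_const s).div_const ε).arctan.congr_deriv ?_
    field_simp
    ring
  · refine Continuous.intervalIntegrable (Continuous.div₀ (by fun_prop) (by fun_prop) ?_) _ _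
    intro x
    positivity

theorem tendsto_arctan_div_nhdsGT_zero (x : ℝ) :
    Tendsto (fun ε : ℝ => Real.arctan (x / ε)) (𝓝[>] 0) (𝓝 (π / 2 * SignType.sign x)) := by
  rcases lt_trichotomy x 0 with hx | rfl | hx
  · have : Tendsto (fun ε : ℝ => x / ε) (𝓝[>] 0) atBot := by
      simpa only [div_eq_mul_inv] using tendsto_inv_nhdsGT_zero.const_mul_atTop_of_neg hx
    simpa [sign_neg hx, Function.comp_def] using
      (tendsto_nhds_of_tendsto_nhdsWithin Real.tendsto_arctan_atBot).comp this
  · simp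
  · have : Tendsto (fun ε : ℝ => x / ε) (𝓝[>] 0) atTop := by
      simpa only [div_eq_mul_inv] using tendsto_inv_nhdsGT_zero.const_mul_atTop hx
    simpa [sign_pos hx, Function.comp_def] using
      (tendsto_nhds_of_tendsto_nhdsWithin Real.tendsto_arctan_atTop).comp this

/-- **Stieltjes inversion formula**. -/
theorem tendsto_intervalIntegral_stieltjes_im (μ : Measure ℝ) [IsFiniteMeasure μ] {c d : ℝ}
    (hcd : c < d) :
    Tendsto (fun ε : ℝ => ∫ x in c..d, (stieltjes μ (x + ε * Complex.I)).im) (𝓝[>] 0)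
      (𝓝 (π / 2 * (μ.real (Ioo c d) + μ.real (Icc c d)))) := by
  have hlim : Tendsto (fun ε : ℝ => ∫ s, (Real.arctan ((d - s) / ε) - Real.arctan ((c - s) / ε)) ∂μ)
      (𝓝[>] 0) (𝓝 (∫ s, (π / 2 * SignType.sign (d - s) - π / 2 * SignType.sign (c - s)) ∂μ)) := by
    refine tendsto_integral_filter_of_dominated_convergence (fun _ => π)
      (Eventually.of_forall fun ε => ?_) (Eventually.of_forall fun ε => ae_of_all _ fun s => ?_)
      (integrable_const _) (ae_of_all _ fun s => ?_)
    · exact (by fun_prop : Continuous fun s : ℝ =>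
        Real.arctan ((d - s) / ε) - Real.arctan ((c - s) / ε)).aestronglyMeasurable
    · rw [Real.norm_eq_abs, abs_le]
      constructor <;> linarith [Real.arctan_lt_pi_div_two ((d - s) / ε),
        Real.neg_pi_div_two_lt_arctan ((d - s) / ε), Real.arctan_lt_pi_div_two ((c - s) / ε),
        Real.neg_pi_div_two_lt_arctan ((c - s) / ε)]
    · exact (tendsto_arctan_div_nhdsGT_zero _).sub (tendsto_arctan_div_nhdsGT_zero _)
  have hval : ∫ s, (π / 2 * SignType.sign (d - s) - π / 2 * SignType.sign (c - s)) ∂μ =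
      π / 2 * (μ.real (Ioo c d) + μ.real (Icc c d)) := by
    rw [← integral_indicator_one measurableSet_Ioo, ← integral_indicator_one measurableSet_Icc,
      ← integral_add, ← integral_const_mul]
    · refine integral_congr_ae (ae_of_all _ fun s => ?_)
      simp only [indicator_apply, mem_Ioo, mem_Icc, Pi.one_apply]
      rcases lt_trichotomy s c with h | rfl | h
      · simp [h, h.trans hcd, h.not_ge, h.not_gt]
      · simp [hcd, hcd.le]
      · rcases lt_trichotomy s d with h' | rfl | h'
        · simp [h, h', h.le, h'.le]
          ring
        · simp [h, h.le]
        · simp [h, h', h'.not_ge, h'.not_gt]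
    · exact (integrable_const 1).indicator measurableSet_Ioo
    · exact (integrable_const 1).indicator measurableSet_Icc
  rw [hval] at hlim
  refine hlim.congr' ?_
  filter_upwards [self_mem_nhdsWithin] with ε hε
  have hε : 0 < ε := hε
  simp only [stieltjes_im μ _ hε]
  rw [intervalIntegral_integral_swap]
  · simp only [intervalIntegral_poisson _ c d hε]
  · have : IsFiniteMeasure (volume.restrict (Ι c d)) := ⟨by simp [uIoc_of_le hcd.le]⟩
    refine Integrable.of_bound (C := ε⁻¹) ?_ (ae_of_all _ fun p => ?_)
    · refine Continuous.aestronglyMeasurable ?_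
      simp only [Function.uncurry_def]
      refine Continuous.div₀ (by fun_prop) (by fun_prop) fun p => ?_
      positivity
    · simp only [Function.uncurry_def]
      rw [Real.norm_of_nonneg (by positivity), div_le_iff₀ (by positivity)]
      have : ε⁻¹ * ε ^ 2 = ε := by field_simp
      have h2 : 0 ≤ ε⁻¹ * (p.2 - p.1) ^ 2 := by positivity
      linarith [mul_add ε⁻¹ ((p.2 - p.1) ^ 2) (ε ^ 2)]

/-- If the Stieltjes inversion formula for `μ` yields the integral of a continuous function `h`, then
`μ` has no atoms and `h / π` is its density. -/
theorem measureReal_Ioc_eq_of_inversion {μ : Measure ℝ} [IsFiniteMeasure μ] {a b : ℝ}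
    {h : ℝ → ℝ} (hc : ContinuousOn h (Ioo a b))
    (hI : ∀ c d, a < c → c < d → d < b →
      π / 2 * (μ.real (Ioo c d) + μ.real (Icc c d)) = ∫ x in c..d, h x)
    {c d : ℝ} (hac : a < c) (hcd : c < d) (hdb : d < b) :
    μ.real (Ioc c d) = ∫ x in c..d, h x / π := by
  have hatom : ∀ c, a < c → c < b → μ.real {c} = 0 := by
    intro c hac hcb
    obtain ⟨e, hce, heb⟩ := exists_between hcb
    have hint : IntegrableOn h (Icc c e) :=
      (hc.mono fun x hx => ⟨hac.trans_le hx.1, hx.2.trans_lt heb⟩).integrableOn_Icc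
    have hcont := intervalIntegral.continuousOn_primitive_interval
      (f := h) (a := c) (b := e) (μ := volume) (by rwa [uIcc_of_le hce.le])
    have h0 : Tendsto (fun x => ∫ t in c..x, h t) (𝓝[>] c) (𝓝 0) := by
      have h1 := hcont c left_mem_uIcc
      rw [uIcc_of_le hce.le] at h1
      have h2 : Tendsto (fun x => ∫ t in c..x, h t) (𝓝[Icc c e] c) (𝓝 (∫ t in c..c, h t)) := h1
      rw [intervalIntegral.integral_same] at h2
      refine h2.mono_left ?_
      rw [← nhdsWithin_Ioo_eq_nhdsGT hce]
      exact nhdsWithin_mono _ Ioo_subset_Icc_self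
    have hle : π / 2 * μ.real {c} ≤ 0 := by
      refine ge_of_tendsto h0 ?_
      filter_upwards [Ioo_mem_nhdsGT hcb] with x hx
      rw [← hI c x hac hx.1 hx.2]
      have h3 : μ.real {c} ≤ μ.real (Icc c x) :=
        measureReal_mono (singleton_subset_iff.2 ⟨le_rfl, hx.1.le⟩)
      have h4 : 0 ≤ μ.real (Ioo c x) := measureReal_nonneg
      gcongr
      linarith
    have h5 : 0 ≤ μ.real {c} := measureReal_nonneg
    nlinarith [Real.pi_pos]
  have hc0 := hatom c hac (hcd.trans hdb)
  have hd0 := hatom d (hac.trans hcd) hdb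
  have e1 : μ.real (Ioc c d) = μ.real (Ioo c d) := by
    refine le_antisymm ?_ (measureReal_mono Ioo_subset_Ioc_self)
    rw [← Ioo_union_right hcd]
    exact (measureReal_union_le _ _).trans (by rw [hd0, add_zero])
  have e2 : μ.real (Icc c d) = μ.real (Ioc c d) := by
    refine le_antisymm ?_ (measureReal_mono Ioc_subset_Icc_self)
    rw [← Ioc_union_left hcd.le]
    exact (measureReal_union_le _ _).trans (by rw [hc0, add_zero])
  have := hI c d hac hcd hdb
  rw [e2, ← e1] at this
  rw [intervalIntegral.integral_div, ← this]
  field_simp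
  ring

/-- If the Stieltjes transform of `μ` continues holomorphically from the upper half-plane to a disc
centred on the real line, then `μ` has a nonnegative density on the real diameter of the disc which
is the restriction of a holomorphic function. -/
theorem exists_density_of_exists_continuation {μ : Measure ℝ} [IsFiniteMeasure μ]
    {t r : ℝ} (hr : 0 < r) {F : ℂ → ℂ} (hF : DifferentiableOn ℂ F (ball (t : ℂ) r))
    (hFμ : ∀ z ∈ ball (t : ℂ) r, 0 < z.im → F z = stieltjes μ z) :
    ∃ Φ : ℂ → ℂ, DifferentiableOn ℂ Φ (ball (t : ℂ) r) ∧
      (∀ x : ℝ, (x : ℂ) ∈ ball (t : ℂ) r → (Φ x).im = 0) ∧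
      (∀ x ∈ Ioo (t - r) (t + r), 0 ≤ (Φ x).re) ∧
      μ.restrict (Ioo (t - r) (t + r)) = (volume.restrict (Ioo (t - r) (t + r))).withDensity
        fun x => ENNReal.ofReal (Φ x).re := by
  have hreal : ∀ x : ℝ, (F x - conj (F (conj (x : ℂ)))) / (2 * π * Complex.I) =
      (((F x).im / π : ℝ) : ℂ) := by
    intro x
    rw [Complex.conj_ofReal, Complex.sub_conj]
    have := Real.pi_ne_zero
    push_cast
    field_simp
  have hlim : ∀ x ∈ Ioo (t - r) (t + r),
      Tendsto (fun ε : ℝ => F (x + ε * Complex.I)) (𝓝[>] 0) (𝓝 (F x)) := by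
    intro x hx
    have h1 := (hF.differentiableAt (isOpen_ball.mem_nhds (ofReal_mem_ball_iff.2 hx))).continuousAt
    have h2 : Tendsto (fun ε : ℝ => (x : ℂ) + ε * Complex.I) (𝓝[>] 0) (𝓝 x) := by
      refine tendsto_nhdsWithin_of_tendsto_nhds ?_
      have : Continuous fun ε : ℝ => (x : ℂ) + ε * Complex.I := by fun_prop
      simpa using this.tendsto 0
    exact h1.tendsto.comp h2
  have hmem : ∀ x ∈ Ioo (t - r) (t + r), ∀ᶠ ε : ℝ in 𝓝[>] 0,
      (x : ℂ) + ε * Complex.I ∈ ball (t : ℂ) r := by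
    intro x hx
    have : Continuous fun ε : ℝ => (x : ℂ) + ε * Complex.I := by fun_prop
    refine tendsto_nhdsWithin_of_tendsto_nhds (this.tendsto 0) (isOpen_ball.mem_nhds ?_)
    simpa using ofReal_mem_ball_iff.2 hx
  have him : ∀ x ε : ℝ, 0 < ε → ((x : ℂ) + ε * Complex.I) ∈ ball (t : ℂ) r →
      (F (x + ε * Complex.I)).im = (stieltjes μ (x + ε * Complex.I)).im := by
    intro x ε hε h
    rw [hFμ _ h (by simpa using hε)]
  have hnonneg : ∀ x ∈ Ioo (t - r) (t + r), 0 ≤ (F x).im := by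
    intro x hx
    refine ge_of_tendsto ((Complex.continuous_im.tendsto _).comp (hlim x hx)) ?_
    filter_upwards [hmem x hx, self_mem_nhdsWithin] with ε h1 h2
    have h2 : 0 < ε := h2
    rw [Function.comp_apply, him x ε h2 h1, stieltjes_im μ x h2]
    exact integral_nonneg fun s => by positivity
  have hcont : ContinuousOn (fun x : ℝ => (F x).im) (Ioo (t - r) (t + r)) :=
    Complex.continuous_im.comp_continuousOn (hF.continuousOn.comp
      Complex.continuous_ofReal.continuousOn fun x hx => ofReal_mem_ball_iff.2 hx)
  have hinv : ∀ c d, t - r < c → c < d → d < t + r →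
      π / 2 * (μ.real (Ioo c d) + μ.real (Icc c d)) = ∫ x in c..d, (F x).im := by
    intro c d hc hcd hd
    refine tendsto_nhds_unique (tendsto_intervalIntegral_stieltjes_im μ hcd) ?_
    obtain ⟨ρ, hρ, hρr⟩ : ∃ ρ, max (|c - t|) (|d - t|) < ρ ∧ ρ < r := by
      refine exists_between (max_lt ?_ ?_) <;> rw [abs_lt] <;> constructor <;> linarith
    obtain ⟨hρc, hρd⟩ := max_lt_iff.1 hρ
    have hsub : closedBall (t : ℂ) ρ ⊆ ball (t : ℂ) r := closedBall_subset_ball hρr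
    obtain ⟨C, hC⟩ := (isCompact_closedBall (t : ℂ) ρ).exists_bound_of_continuousOn
      (hF.continuousOn.mono hsub)
    have hsmall : ∀ᶠ ε : ℝ in 𝓝[>] 0, 0 < ε ∧ ∀ x ∈ Ι c d,
        (x : ℂ) + ε * Complex.I ∈ closedBall (t : ℂ) ρ := by
      have hpos : 0 < ρ - max (|c - t|) (|d - t|) := by linarith
      filter_upwards [Ioo_mem_nhdsGT hpos] with ε hε
      refine ⟨hε.1, fun x hx => ?_⟩
      rw [uIoc_of_le hcd.le] at hx
      have h1 : |x - t| ≤ max |c - t| |d - t| := by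
        rw [abs_le]
        constructor
        · linarith [hx.1, neg_abs_le (c - t), le_max_left |c - t| |d - t|]
        · linarith [hx.2, le_abs_self (d - t), le_max_right |c - t| |d - t|]
      rw [mem_closedBall, Complex.dist_eq]
      have h2 : (x : ℂ) + ε * Complex.I - t = ((x - t : ℝ) : ℂ) + ε * Complex.I := by
        push_cast; ring
      rw [h2]
      refine (norm_add_le _ _).trans ?_
      rw [norm_mul, Complex.norm_I, Complex.norm_real, Complex.norm_real, mul_one,
        Real.norm_eq_abs, Real.norm_of_nonneg hε.1.le]
      linarith [hε.2]
    have hlim2 : Tendsto (fun ε : ℝ => ∫ x in c..d, (F (x + ε * Complex.I)).im) (𝓝[>] 0)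
        (𝓝 (∫ x in c..d, (F x).im)) := by
      refine intervalIntegral.tendsto_integral_filter_of_dominated_convergence (fun _ => C)
        ?_ ?_ (by simp) (ae_of_all _ fun x hx => ?_)
      · filter_upwards [hsmall] with ε hε
        refine ContinuousOn.aestronglyMeasurable ?_ measurableSet_uIoc
        exact Complex.continuous_im.comp_continuousOn (hF.continuousOn.comp
          (by fun_prop) fun x hx => hsub (hε.2 x hx))
      · filter_upwards [hsmall] with ε hε
        refine ae_of_all _ fun x hx => ?_
        exact (Complex.abs_im_le_norm _).trans (hC _ (hε.2 x hx))
      · rw [uIoc_of_le hcd.le] at hx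
        exact (Complex.continuous_im.tendsto _).comp
          (hlim x ⟨hc.trans hx.1, hx.2.trans_lt hd⟩)
    refine hlim2.congr' ?_
    filter_upwards [hsmall] with ε hε
    refine intervalIntegral.integral_congr_ae (ae_of_all _ fun x hx => ?_)
    exact him x ε hε.1 (hsub (hε.2 x hx))
  refine ⟨fun z => (F z - conj (F (conj z))) / (2 * π * Complex.I), ?_, ?_, ?_, ?_⟩
  · refine DifferentiableOn.div_const (hF.fun_sub fun z hz => ?_) _
    have hz' : conj z ∈ ball (t : ℂ) r := by
      rw [mem_ball, ← Complex.conj_ofReal t, Complex.dist_conj_conj]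
      exact hz
    have := (hF.differentiableAt (isOpen_ball.mem_nhds hz')).conj_conj
    rw [Complex.conj_conj] at this
    exact this.differentiableWithinAt
  · intro x _
    simp only [hreal, Complex.ofReal_im]
  · intro x hx
    simp only [hreal, Complex.ofReal_re]
    exact div_nonneg (hnonneg x hx) Real.pi_pos.le
  · simp only [hreal, Complex.ofReal_re]
    exact restrict_eq_withDensity_of_measureReal_Ioc_eq (by linarith) (hcont.div_const _)
      (fun x hx => div_nonneg (hnonneg x hx) Real.pi_pos.le)
      fun c d hc hcd hd => measureReal_Ioc_eq_of_inversion hcont hinv hc hcd hd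

theorem norm_dslope_le {Φ : ℂ → ℂ} {s : Set ℂ} (hs : Convex ℝ s)
    (hΦ : ∀ x ∈ s, DifferentiableAt ℂ Φ x) {C : ℝ} (hC : ∀ x ∈ s, ‖deriv Φ x‖ ≤ C) {x z : ℂ}
    (hx : x ∈ s) (hz : z ∈ s) : ‖dslope Φ x z‖ ≤ C := by
  rcases eq_or_ne z x with rfl | hne
  · rw [dslope_same]
    exact hC _ hx
  · rw [dslope_of_ne _ hne, slope_def_field, norm_div,
      div_le_iff₀ (norm_pos_iff.2 (sub_ne_zero.2 hne))]
    exact hs.norm_image_sub_le_of_norm_deriv_le hΦ hC hx hz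

/-- The regularised Cauchy integral `z ↦ ∫ (Φ x - Φ z) / (x - z) dx` over the real diameter of a disc
is holomorphic on the disc. -/
theorem differentiableOn_integral_dslope {Φ : ℂ → ℂ} {t r : ℝ}
    (hΦ : DifferentiableOn ℂ Φ (ball (t : ℂ) r))
    (hint : IntegrableOn (fun x : ℝ => Φ x) (Ioo (t - r) (t + r))) :
    DifferentiableOn ℂ (fun z => ∫ x : ℝ in Ioo (t - r) (t + r), dslope Φ x z)
      (ball (t : ℂ) r) := by
  have hmeas : ∀ z ∈ ball (t : ℂ) r, AEStronglyMeasurable (fun x : ℝ => dslope Φ x z)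
      (volume.restrict (Ioo (t - r) (t + r))) := by
    intro z hz
    have h1 : AEStronglyMeasurable (fun x : ℝ => (z - x)⁻¹ * (Φ z - Φ x))
        (volume.restrict (Ioo (t - r) (t + r))) := by
      refine AEStronglyMeasurable.mul ?_ (aestronglyMeasurable_const.sub hint.aestronglyMeasurable)
      exact (by fun_prop : Measurable fun x : ℝ => (z - (x : ℂ))⁻¹).aestronglyMeasurable
    refine h1.congr (ae_restrict_of_ae ?_)
    have : ∀ᵐ x : ℝ, x ≠ z.re := by simp [ae_iff]
    filter_upwards [this] with x hx
    have hne : z ≠ (x : ℂ) := fun h => hx (by rw [h, Complex.ofReal_re])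
    rw [dslope_of_ne _ hne, slope_def_field, div_eq_inv_mul]
  refine differentiableOn_integral_of_locally_dominated isOpen_ball hmeas ?_ ?_
  · refine (ae_restrict_iff' measurableSet_Ioo).2 (ae_of_all _ fun x hx => ?_)
    exact (Complex.differentiableOn_dslope
      (isOpen_ball.mem_nhds (ofReal_mem_ball_iff.2 hx))).2 hΦ
  · intro z₀ hz₀
    obtain ⟨ρ, hρ0, hρr⟩ := exists_between (mem_ball.1 hz₀)
    obtain ⟨ρ', hρ', hρr'⟩ := exists_between hρr
    have hsub : closedBall (t : ℂ) ρ' ⊆ ball (t : ℂ) r := closedBall_subset_ball hρr'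
    have hd : DifferentiableOn ℂ (deriv Φ) (ball (t : ℂ) r) := hΦ.deriv isOpen_ball
    obtain ⟨C, hC⟩ := (isCompact_closedBall (t : ℂ) ρ').exists_bound_of_continuousOn
      (hΦ.continuousOn.mono hsub)
    obtain ⟨C', hC'⟩ := (isCompact_closedBall (t : ℂ) ρ').exists_bound_of_continuousOn
      (hd.continuousOn.mono hsub)
    have hz₀' : z₀ ∈ closedBall (t : ℂ) ρ' := by
      rw [mem_closedBall]; linarith
    have hC0 : 0 ≤ C := (norm_nonneg _).trans (hC z₀ hz₀')
    have hC'0 : 0 ≤ C' := (norm_nonneg _).trans (hC' z₀ hz₀')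
    have hδ : 0 < ρ' - ρ := by linarith
    refine ⟨ρ - dist z₀ t, by linarith, fun x => C' + (C + ‖Φ x‖) / (ρ' - ρ), ?_, ?_⟩
    · exact (integrable_const _).add (((integrable_const _).add hint.norm).div_const _)
    · refine ae_of_all _ fun x z hz => ?_
      have hz : dist z t < ρ := by
        linarith [mem_ball.1 hz, dist_triangle z z₀ t]
      have hzc : z ∈ closedBall (t : ℂ) ρ' := by
        rw [mem_closedBall]; linarith
      have h0 : 0 ≤ (C + ‖Φ x‖) / (ρ' - ρ) := by positivity
      by_cases hx : (x : ℂ) ∈ closedBall (t : ℂ) ρ'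
      · have := norm_dslope_le (convex_closedBall _ _)
          (fun y hy => hΦ.differentiableAt (isOpen_ball.mem_nhds (hsub hy))) hC' hx hzc
        linarith
      · have hx : ρ' < dist (x : ℂ) t := by simpa using hx
        have hdist : ρ' - ρ ≤ ‖z - x‖ := by
          rw [← dist_eq_norm, dist_comm]
          linarith [dist_triangle (x : ℂ) z t]
        have hne : z ≠ x := fun h => by
          rw [h, sub_self, norm_zero] at hdist
          linarith
        rw [dslope_of_ne _ hne, slope_def_field, norm_div]
        have : ‖Φ z - Φ x‖ / ‖z - x‖ ≤ (C + ‖Φ x‖) / (ρ' - ρ) := by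
          gcongr
          exact (norm_sub_le _ _).trans (by linarith [hC z hzc])
        linarith

theorem integral_Ioo_inv_ofReal_sub {a b : ℝ} (hab : a ≤ b) {z : ℂ} (hz : 0 < z.im) :
    ∫ x : ℝ in Ioo a b, ((x : ℂ) - z)⁻¹ =
      Complex.log (Complex.I * (b - z)) - Complex.log (Complex.I * (a - z)) := by
  have hne : ∀ s : ℝ, (s : ℂ) - z ≠ 0 := fun s h => hz.ne' (by simpa using congrArg Complex.im h)
  rw [← integral_Ioc_eq_integral_Ioo, ← intervalIntegral.integral_of_le hab]
  refine intervalIntegral.integral_eq_sub_of_hasDerivAt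
    (f := fun x : ℝ => Complex.log (Complex.I * (x - z))) (fun x _ => ?_) ?_
  · refine ((((hasDerivAt_id' x).ofReal_comp.sub_const z).const_mul Complex.I).clog_real
      (Or.inl ?_)).congr_deriv ?_
    · simpa using hz
    · have := hne x
      have := Complex.I_ne_zero
      push_cast
      field_simp
  · exact (Continuous.inv₀ (by fun_prop) hne).intervalIntegrable _ _

/-- If `μ` has a nonnegative density on an interval which is the restriction of a function
holomorphic on a disc, then its Stieltjes transform continues holomorphically from the upper
half-plane to that disc. -/
theorem exists_continuation_of_density {μ : Measure ℝ} [IsFiniteMeasure μ]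
    {t r : ℝ} (hr : 0 < r) {Φ : ℂ → ℂ} (hΦ : DifferentiableOn ℂ Φ (ball (t : ℂ) r))
    (hreal : ∀ x : ℝ, (x : ℂ) ∈ ball (t : ℂ) r → (Φ x).im = 0)
    (hnonneg : ∀ x ∈ Ioo (t - r) (t + r), 0 ≤ (Φ x).re)
    (hμ : μ.restrict (Ioo (t - r) (t + r)) = (volume.restrict (Ioo (t - r) (t + r))).withDensity
        fun x => ENNReal.ofReal (Φ x).re) :
    ∃ F : ℂ → ℂ, DifferentiableOn ℂ F (ball (t : ℂ) r) ∧
      ∀ z ∈ ball (t : ℂ) r, 0 < z.im → F z = stieltjes μ z := by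
  set I := Ioo (t - r) (t + r) with hI
  have hcont : ContinuousOn (fun x : ℝ => Φ x) I := hΦ.continuousOn.comp
    Complex.continuous_ofReal.continuousOn fun x hx => ofReal_mem_ball_iff.2 hx
  have haesm : AEStronglyMeasurable (fun x : ℝ => (Φ x).re) (volume.restrict I) :=
    (Complex.continuous_re.comp_continuousOn hcont).aestronglyMeasurable measurableSet_Ioo
  have hre : Integrable (fun x : ℝ => (Φ x).re) (volume.restrict I) := by
    refine ⟨haesm, ?_⟩
    rw [hasFiniteIntegral_iff_ofReal
      ((ae_restrict_iff' measurableSet_Ioo).2 (ae_of_all _ hnonneg))]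
    have := measure_lt_top (μ.restrict I) univ
    rwa [hμ, withDensity_apply _ MeasurableSet.univ, Measure.restrict_univ] at this
  have hofReal : ∀ x ∈ I, ((Φ x).re : ℂ) = Φ x := fun x hx =>
    Complex.ext rfl (by simp [hreal x (ofReal_mem_ball_iff.2 hx)])
  have hint : IntegrableOn (fun x : ℝ => Φ x) I := by
    refine hre.ofReal.congr ((ae_restrict_iff' measurableSet_Ioo).2 (ae_of_all _ fun x hx => ?_))
    exact hofReal x hx
  have hdiff := differentiableOn_integral_dslope hΦ hint
  have hout : DifferentiableOn ℂ (fun z : ℂ => ∫ s in Iᶜ, ((s : ℂ) - z)⁻¹ ∂μ)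
      (ball (t : ℂ) r) := by
    have hfar : ∀ z : ℂ, ∀ s ∈ Iᶜ, r - dist z t ≤ ‖(s : ℂ) - z‖ := by
      intro z s hs
      have hs : r ≤ dist (s : ℂ) t := by
        rw [mem_compl_iff, hI, ← ofReal_mem_ball_iff, mem_ball, not_lt] at hs
        exact hs
      rw [← dist_eq_norm]
      linarith [dist_triangle (s : ℂ) z t]
    refine differentiableOn_integral_of_locally_dominated isOpen_ball (fun z _ => ?_) ?_ ?_
    · exact (by fun_prop : Measurable fun s : ℝ => ((s : ℂ) - z)⁻¹).aestronglyMeasurable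
    · refine (ae_restrict_iff' measurableSet_Ioo.compl).2 (ae_of_all _ fun s hs z hz => ?_)
      have hne : (s : ℂ) - z ≠ 0 := by
        rw [← norm_pos_iff]
        linarith [hfar z s hs, mem_ball.1 hz]
      exact ((differentiableAt_id.const_sub (s : ℂ)).inv hne).differentiableWithinAt
    · intro z₀ hz₀
      rw [mem_ball] at hz₀
      refine ⟨(r - dist z₀ t) / 2, by linarith, fun _ => ((r - dist z₀ t) / 2)⁻¹,
        integrable_const _, ?_⟩
      refine (ae_restrict_iff' measurableSet_Ioo.compl).2 (ae_of_all _ fun s hs z hz => ?_)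
      rw [norm_inv]
      refine inv_anti₀ (by linarith) ?_
      linarith [hfar z s hs, mem_ball.1 hz, dist_triangle z z₀ t]
  have hre_mem : ∀ z ∈ ball (t : ℂ) r, t - r < z.re ∧ z.re < t + r := by
    intro z hz
    rw [mem_ball, Complex.dist_eq] at hz
    have := (Complex.abs_re_le_norm (z - t)).trans_lt hz
    rw [Complex.sub_re, Complex.ofReal_re, abs_lt] at this
    constructor <;> linarith
  have hlog : ∀ e : ℝ, (∀ z ∈ ball (t : ℂ) r, e - z.re ≠ 0) → DifferentiableOn ℂ
      (fun z : ℂ => Complex.log (Complex.I * (e - z))) (ball (t : ℂ) r) := by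
    intro e he
    refine DifferentiableOn.clog (by fun_prop) fun z hz => Or.inr ?_
    simpa using he z hz
  refine ⟨fun z => (∫ s in Iᶜ, ((s : ℂ) - z)⁻¹ ∂μ) + (∫ x : ℝ in I, dslope Φ x z) +
    Φ z * (Complex.log (Complex.I * ((t + r : ℝ) - z)) -
      Complex.log (Complex.I * ((t - r : ℝ) - z))), ?_, fun z hz hzim => ?_⟩
  · refine (hout.fun_add hdiff).fun_add
      (hΦ.fun_mul ((hlog _ fun z hz => ?_).fun_sub (hlog _ fun z hz => ?_)))
    · linarith [(hre_mem z hz).2]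
    · linarith [(hre_mem z hz).1]
  · have hne : ∀ s : ℝ, (s : ℂ) - z ≠ 0 := fun s h =>
      hzim.ne' (by simpa using congrArg Complex.im h)
    have hkint := integrable_stieltjes_kernel μ hzim.ne'
    have hkint' : Integrable (fun x : ℝ => ((x : ℂ) - z)⁻¹) (volume.restrict I) :=
      integrable_stieltjes_kernel _ hzim.ne'
    have hΦk : Integrable (fun x : ℝ => ((x : ℂ) - z)⁻¹ * Φ x) (volume.restrict I) := by
      refine hint.bdd_mul (c := |z.im|⁻¹) hkint'.aestronglyMeasurable (ae_of_all _ fun s => ?_)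
      rw [norm_inv]
      refine inv_anti₀ (abs_pos.2 hzim.ne') ?_
      simpa using Complex.abs_im_le_norm ((s : ℂ) - z)
    have hin : ∫ s in I, ((s : ℂ) - z)⁻¹ ∂μ = ∫ x : ℝ in I, ((x : ℂ) - z)⁻¹ * Φ x := by
      rw [hμ, integral_withDensity_eq_integral_toReal_smul₀
        haesm.aemeasurable.ennreal_ofReal (ae_of_all _ fun _ => ENNReal.ofReal_lt_top)]
      refine setIntegral_congr_fun measurableSet_Ioo fun x hx => ?_
      rw [ENNReal.toReal_ofReal (hnonneg x hx), Complex.real_smul, hofReal x hx, mul_comm]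
    have hds : ∫ x : ℝ in I, dslope Φ x z =
        (∫ x : ℝ in I, ((x : ℂ) - z)⁻¹ * Φ x) - (∫ x : ℝ in I, ((x : ℂ) - z)⁻¹) * Φ z := by
      rw [← integral_mul_const, ← integral_sub hΦk (hkint'.mul_const _)]
      refine integral_congr_ae (ae_of_all _ fun x => ?_)
      have h1 : z ≠ x := fun h => hne x (by rw [h, sub_self])
      simp only
      rw [dslope_of_ne _ h1, slope_def_field, ← neg_sub (x : ℂ) z, div_neg, div_eq_inv_mul]
      ring
    simp only
    rw [← integral_Ioo_inv_ofReal_sub (by linarith) hzim, hds, stieltjes,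
      ← integral_add_compl measurableSet_Ioo hkint, ← hI, hin]
    ring

/-- A continuous function positive at `x` has positive integral over some compact interval inside
any prescribed neighbourhood of `x`. -/
theorem setIntegral_Icc_pos_of_continuousOn {φ : ℝ → ℝ} {a b x : ℝ} (hx : x ∈ Ioo a b)
    (hφ : ContinuousOn φ (Ioo a b)) (hpos : 0 < φ x) {δ : ℝ} (hδ : 0 < δ) :
    ∃ p q, x - δ < p ∧ p < q ∧ q < x + δ ∧ Icc p q ⊆ Ioo a b ∧ 0 < ∫ y in Icc p q, φ y := by
  have hev : ∀ᶠ y in 𝓝 x, 0 < φ y ∧ y ∈ Ioo a b :=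
    ((hφ.continuousAt (isOpen_Ioo.mem_nhds hx)).eventually_const_lt hpos).and
      (isOpen_Ioo.mem_nhds hx)
  obtain ⟨e, he, hball⟩ := Metric.eventually_nhds_iff.1 hev
  have hm : 0 < min e δ := lt_min he hδ
  have hsub : ∀ y ∈ Icc (x - min e δ / 2) (x + min e δ / 2), 0 < φ y ∧ y ∈ Ioo a b := by
    intro y hy
    refine hball ?_
    rw [Real.dist_eq, abs_lt]
    constructor <;> linarith [hy.1, hy.2, min_le_left e δ]
  have hlt : x - min e δ / 2 < x + min e δ / 2 := by linarith
  refine ⟨_, _, ?_, hlt, ?_, fun y hy => (hsub y hy).2, ?_⟩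
  · linarith [min_le_right e δ]
  · linarith [min_le_right e δ]
  · rw [integral_Icc_eq_integral_Ioc, ← intervalIntegral.integral_of_le hlt.le]
    refine intervalIntegral.intervalIntegral_pos_of_pos_on ?_
      (fun y hy => (hsub y (Ioo_subset_Icc_self hy)).1) hlt
    exact (hφ.mono fun y hy => (hsub y (by rwa [uIcc_of_le hlt.le] at hy)).2).intervalIntegrable

/-- If `A ↦ max (∫ x in A, φ x) 0` agrees with a measure on the Borel subsets of an interval on
which `φ` is continuous, then `φ` cannot change sign there. -/
theorem nonneg_or_nonpos_of_measure_eq_ofReal_integral {μ : Measure ℝ} {a b : ℝ} {φ : ℝ → ℝ}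
    (hφ : ContinuousOn φ (Ioo a b))
    (hμ : ∀ A, MeasurableSet A → A ⊆ Ioo a b → μ A = ENNReal.ofReal (∫ x in A, φ x)) :
    (∀ x ∈ Ioo a b, 0 ≤ φ x) ∨ ∀ x ∈ Ioo a b, φ x ≤ 0 := by
  by_contra! h
  obtain ⟨⟨x, hx, hxneg⟩, y, hy, hypos⟩ := h
  have hxy : x ≠ y := fun h => by rw [h] at hxneg; linarith
  have hδ : 0 < |x - y| / 2 := half_pos (abs_pos.2 (sub_ne_zero.2 hxy))
  obtain ⟨p, q, h1, -, h2, hsub, hint⟩ :=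
    setIntegral_Icc_pos_of_continuousOn hx hφ.neg (by simpa using hxneg) hδ
  obtain ⟨p', q', h1', -, h2', hsub', hint'⟩ :=
    setIntegral_Icc_pos_of_continuousOn hy hφ hypos hδ
  have hdisj : Disjoint (Icc p q) (Icc p' q') := by
    rw [Set.disjoint_left]
    intro w hw hw'
    rcases abs_cases (x - y) with h | h <;> linarith [hw.1, hw.2, hw'.1, hw'.2]
  simp only [Pi.neg_apply, integral_neg] at hint
  have hun := hμ _ (measurableSet_Icc.union measurableSet_Icc) (union_subset hsub hsub')
  rw [measure_union hdisj measurableSet_Icc, hμ _ measurableSet_Icc hsub,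
    hμ _ measurableSet_Icc hsub', setIntegral_union hdisj measurableSet_Icc
      (hφ.mono hsub).integrableOn_Icc (hφ.mono hsub').integrableOn_Icc,
    ENNReal.ofReal_of_nonpos (by linarith), zero_add] at hun
  have := (ENNReal.ofReal_lt_ofReal_iff hint').2
    (by linarith : (∫ x in Icc p q, φ x) + ∫ x in Icc p' q', φ x < ∫ x in Icc p' q', φ x)
  exact this.ne hun.symm

theorem restrict_eq_withDensity_of_measure_eq_ofReal_integral {μ : Measure ℝ} [IsFiniteMeasure μ]
    {a b : ℝ} (hab : a < b) {φ : ℝ → ℝ} (hφ : ContinuousOn φ (Ioo a b))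
    (h0 : ∀ x ∈ Ioo a b, 0 ≤ φ x)
    (hμ : ∀ A, MeasurableSet A → A ⊆ Ioo a b → μ A = ENNReal.ofReal (∫ x in A, φ x)) :
    μ.restrict (Ioo a b) =
      (volume.restrict (Ioo a b)).withDensity fun x => ENNReal.ofReal (φ x) := by
  refine restrict_eq_withDensity_of_measureReal_Ioc_eq hab hφ h0 fun c d hac hcd hdb => ?_
  have hsub : Ioc c d ⊆ Ioo a b := fun x hx => ⟨hac.trans hx.1, hx.2.trans_lt hdb⟩
  rw [measureReal_def, hμ _ measurableSet_Ioc hsub, intervalIntegral.integral_of_le hcd.le,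
    ENNReal.toReal_ofReal (setIntegral_nonneg measurableSet_Ioc fun x hx => h0 x (hsub hx))]

theorem measure_eq_ofReal_integral_of_restrict_eq_withDensity {μ : Measure ℝ} [IsFiniteMeasure μ]
    {a b : ℝ} {φ : ℝ → ℝ} (hφ : ContinuousOn φ (Ioo a b)) (h0 : ∀ x ∈ Ioo a b, 0 ≤ φ x)
    (hμ : μ.restrict (Ioo a b) =
      (volume.restrict (Ioo a b)).withDensity fun x => ENNReal.ofReal (φ x))
    {A : Set ℝ} (hA : MeasurableSet A) (hsub : A ⊆ Ioo a b) :
    μ A = ENNReal.ofReal (∫ x in A, φ x) := by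
  have h1 : μ A = ∫⁻ x in A, ENNReal.ofReal (φ x) := by
    have := congrArg (fun ν => ν A) hμ
    simpa [Measure.restrict_apply hA, withDensity_apply _ hA, Measure.restrict_restrict hA,
      inter_eq_self_of_subset_left hsub] using this
  have hnn : 0 ≤ᵐ[volume.restrict A] φ :=
    (ae_restrict_iff' hA).2 (ae_of_all _ fun x hx => h0 x (hsub hx))
  rw [h1, ofReal_integral_eq_lintegral_ofReal _ hnn]
  refine ⟨(hφ.mono hsub).aestronglyMeasurable hA, ?_⟩
  rw [hasFiniteIntegral_iff_ofReal hnn, ← h1]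
  exact measure_lt_top _ _

/-- Lemma 7.1: near a point `t₀ > 0` of the real line, the Stieltjes transform of `μ`
extends holomorphically from the upper half-plane through a disc
`U = ball t₀ r`, `0 < r < t₀`, if and only if `μ` is absolutely continuous on
`(t₀ - r, t₀ + r)` with a density which is the restriction of a function
holomorphic on `U` and real-valued on `U ∩ ℝ`. -/
theorem stieltjes_analytic_continuation_iff_analytic_density
    (μ : Measure ℝ) [IsFiniteMeasure μ] (hμ : μ (Set.Iio 0) = 0)
    (t₀ r : ℝ) (ht₀ : 0 < t₀) (hr : 0 < r) (hrt : r < t₀) :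
    (∃ F : ℂ → ℂ, DifferentiableOn ℂ F (ball (t₀ : ℂ) r) ∧
      ∀ z ∈ ball (t₀ : ℂ) r, 0 < z.im → F z = stieltjes μ z) ↔
    (∃ Φ : ℂ → ℂ, DifferentiableOn ℂ Φ (ball (t₀ : ℂ) r) ∧
      (∀ x : ℝ, (x : ℂ) ∈ ball (t₀ : ℂ) r → (Φ x).im = 0) ∧
      (∀ A : Set ℝ, MeasurableSet A → A ⊆ Set.Ioo (t₀ - r) (t₀ + r) →
        μ A = ENNReal.ofReal (∫ x in A, (Φ x).re))) := by

  have hcont : ∀ Φ : ℂ → ℂ, DifferentiableOn ℂ Φ (ball (t₀ : ℂ) r) →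
      ContinuousOn (fun x : ℝ => (Φ x).re) (Ioo (t₀ - r) (t₀ + r)) := fun Φ hΦ =>
    Complex.continuous_re.comp_continuousOn (hΦ.continuousOn.comp
      Complex.continuous_ofReal.continuousOn fun x hx => ofReal_mem_ball_iff.2 hx)
  constructor
  · rintro ⟨F, hF, hFμ⟩
    obtain ⟨Φ, hΦ, hreal, hnonneg, hdens⟩ := exists_density_of_exists_continuation hr hF hFμ
    exact ⟨Φ, hΦ, hreal, fun A hA hsub =>
      measure_eq_ofReal_integral_of_restrict_eq_withDensity (hcont Φ hΦ) hnonneg hdens hA hsub⟩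
  · rintro ⟨Φ, hΦ, hreal, hdens⟩
    rcases nonneg_or_nonpos_of_measure_eq_ofReal_integral (hcont Φ hΦ) hdens with h | h
    · exact exists_continuation_of_density hr hΦ hreal h
        (restrict_eq_withDensity_of_measure_eq_ofReal_integral (by linarith) (hcont Φ hΦ) h hdens)
    · refine exists_continuation_of_density (Φ := fun _ => 0) hr (differentiableOn_const 0)
        (by simp) (by simp) ?_
      have h0 : μ (Ioo (t₀ - r) (t₀ + r)) = 0 := by
        rw [hdens _ measurableSet_Ioo subset_rfl]
        exact ENNReal.ofReal_of_nonpos (setIntegral_nonpos measurableSet_Ioo h)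
      simp [Measure.restrict_eq_zero.2 h0]
end

section
/- For every N ∈ ℕ with N ≥ 1, every k ∈ ℤ³, and every x ∈ Λ with x ≠ 0, where Λ = ∏_{i=1}^3 [k_i/N, (k_i+1)/N) is the corresponding half-open lattice cube of side 1/N, one has N³ · ∫_Λ |y|^{−1/2} dy ≤ 4·|x|^{−1/2}. -/
open MeasureTheory

/-- The half-open lattice cube `∏ i [kᵢ/N, (kᵢ+1)/N)` of side `1/N` in ℝ³. -/
def latticeCube (N : ℕ) (k : Fin 3 → ℤ) : Set (EuclideanSpace ℝ (Fin 3)) :=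
  {x | ∀ i, (k i : ℝ) / N ≤ x i ∧ x i < ((k i : ℝ) + 1) / N}

theorem intervalIntegrable_abs_rpow_neg_half (a b : ℝ) :
    IntervalIntegrable (fun s : ℝ => |s| ^ (-(1 / 2) : ℝ)) volume a b := by
  have nonneg : ∀ c : ℝ, 0 ≤ c →
      IntervalIntegrable (fun s : ℝ => |s| ^ (-(1 / 2) : ℝ)) volume 0 c := by
    intro c hc
    refine (intervalIntegral.intervalIntegrable_rpow' (a := 0) (b := c)
      (r := (-(1 / 2) : ℝ)) (by norm_num)).congr ?_
    intro s hs
    rw [Set.uIoc_of_le hc] at hs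
    simp only [abs_of_pos hs.1]
  have from_zero : ∀ c : ℝ,
      IntervalIntegrable (fun s : ℝ => |s| ^ (-(1 / 2) : ℝ)) volume 0 c := by
    intro c
    rcases le_total 0 c with hc | hc
    · exact nonneg c hc
    · rw [IntervalIntegrable.iff_comp_neg]
      simpa using nonneg (-c) (by linarith)
  exact (from_zero a).symm.trans (from_zero b)

theorem integral_abs_rpow_neg_half_le_of_nonneg {a b : ℝ} (ha : 0 ≤ a) (hab : a < b) :
    ∫ s in a..b, |s| ^ (-(1 / 2) : ℝ) ≤ 2 * (b - a) * b ^ (-(1 / 2) : ℝ) := by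
  have hb : 0 < b := ha.trans_lt hab
  have h : ∫ s in a..b, |s| ^ (-(1 / 2) : ℝ) = ∫ s in a..b, s ^ (-(1 / 2) : ℝ) := by
    refine intervalIntegral.integral_congr fun s hs => ?_
    rw [Set.uIcc_of_le hab.le] at hs
    simp only [abs_of_nonneg (ha.trans hs.1)]
  rw [h, integral_rpow (Or.inl (by norm_num)), Real.rpow_neg hb.le]
  have e : (-(1 / 2) + 1 : ℝ) = 1 / 2 := by norm_num
  rw [e, ← Real.sqrt_eq_rpow, ← Real.sqrt_eq_rpow, ← div_eq_mul_inv, le_div_iff₀ (by positivity)]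
  have h1 := Real.sq_sqrt ha
  have h2 := Real.sq_sqrt hb.le
  nlinarith [Real.sqrt_le_sqrt hab.le, Real.sqrt_nonneg a]

theorem integral_abs_rpow_neg_half_le {a b t : ℝ} (hab : a < b) (h : 0 ≤ a ∨ b ≤ 0)
    (ht : t ∈ Set.Icc a b) (ht0 : t ≠ 0) :
    ∫ s in a..b, |s| ^ (-(1 / 2) : ℝ) ≤ 2 * (b - a) * |t| ^ (-(1 / 2) : ℝ) := by
  have hd : 0 ≤ 2 * (b - a) := by linarith
  rcases h with ha | hb
  · refine (integral_abs_rpow_neg_half_le_of_nonneg ha hab).trans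
      (mul_le_mul_of_nonneg_left ?_ hd)
    refine Real.rpow_le_rpow_of_nonpos (abs_pos.mpr ht0) ?_ (by norm_num)
    rw [abs_of_nonneg (ha.trans ht.1)]
    exact ht.2
  · have hneg := intervalIntegral.integral_comp_neg (a := a) (b := b)
      (fun s : ℝ => |s| ^ (-(1 / 2) : ℝ))
    simp only [abs_neg] at hneg
    rw [hneg]
    have key := integral_abs_rpow_neg_half_le_of_nonneg (a := -b) (b := -a)
      (by linarith) (by linarith)
    rw [show -a - -b = b - a by ring] at key
    refine key.trans (mul_le_mul_of_nonneg_left ?_ hd)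
    refine Real.rpow_le_rpow_of_nonpos (abs_pos.mpr ht0) ?_ (by norm_num)
    rw [abs_of_nonpos (ht.2.trans hb)]
    linarith [ht.1]

theorem map_restrict_latticeCube_eval (N : ℕ) (k : Fin 3 → ℤ) (i : Fin 3) :
    (volume.restrict (latticeCube N k)).map (fun y => y i) =
      ENNReal.ofReal (1 / N) ^ 2 •
        volume.restrict (Set.Ico ((k i : ℝ) / N) (((k i : ℝ) + 1) / N)) := by
  let I : Fin 3 → Set ℝ := fun j => Set.Ico ((k j : ℝ) / N) (((k j : ℝ) + 1) / N)
  have hI : MeasurableSet (Set.univ.pi I) :=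
    MeasurableSet.univ_pi fun _ => measurableSet_Ico
  have hpre : latticeCube N k = (WithLp.ofLp (p := 2)) ⁻¹' (Set.univ.pi I) := by
    ext y
    simp [latticeCube, I, Set.mem_pi]
  have hmp := (PiLp.volume_preserving_ofLp (Fin 3)).restrict_preimage hI
  have hcomp : (fun y : EuclideanSpace ℝ (Fin 3) => y i) =
      Function.eval i ∘ (WithLp.ofLp (p := 2)) := rfl
  rw [hpre, hcomp, ← Measure.map_map (measurable_pi_apply i) hmp.measurable, hmp.map_eq,
    volume_pi, Measure.restrict_pi_pi, Measure.pi_map_eval]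
  congr 1
  have hv : ∀ j, volume (I j) = ENNReal.ofReal (1 / N) := by
    intro j
    simp only [I, Real.volume_Ico]
    congr 1
    ring
  exact (Finset.prod_congr rfl fun j _ => (Measure.restrict_apply_univ _).trans (hv j)).trans
    (by simp)

theorem exists_norm_le_four_mul_abs (x : EuclideanSpace ℝ (Fin 3)) :
    ∃ i, ‖x‖ ≤ 4 * |x i| := by
  obtain ⟨i, -, hi⟩ := Finset.exists_max_image Finset.univ (fun i => |x i|) Finset.univ_nonempty
  refine ⟨i, ?_⟩
  refine abs_le_of_sq_le_sq' ?_ (by positivity) |>.2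
  rw [EuclideanSpace.norm_sq_eq]
  have h : ∀ j, ‖x j‖ ^ 2 ≤ |x i| ^ 2 := fun j =>
    pow_le_pow_left₀ (norm_nonneg _) (hi j (Finset.mem_univ j)) 2
  rw [Fin.sum_univ_three]
  nlinarith [h 0, h 1, h 2, sq_nonneg |x i|]

/-- Estimate (5.5): for any lattice cube `Λ` of side `1/N` and any `x ∈ Λ`, `x ≠ 0`,
the average of `|y|^{-1/2}` over `Λ` is at most `4 |x|^{-1/2}`. -/
theorem average_inv_sqrt_norm_le (N : ℕ) (hN : 1 ≤ N) (k : Fin 3 → ℤ)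
    (x : EuclideanSpace ℝ (Fin 3)) (hx : x ∈ latticeCube N k) (hx0 : x ≠ 0) :
    (N : ℝ) ^ 3 * ∫ y in latticeCube N k, ‖y‖ ^ (-(1 / 2) : ℝ)
      ≤ 4 * ‖x‖ ^ (-(1 / 2) : ℝ) := by
  have hN0 : (0 : ℝ) < N := by exact_mod_cast hN
  have hxpos : 0 < ‖x‖ := norm_pos_iff.mpr hx0
  obtain ⟨i, hi⟩ := exists_norm_le_four_mul_abs x
  have hxi : 0 < |x i| := by linarith
  set a : ℝ := (k i : ℝ) / N with ha
  set b : ℝ := ((k i : ℝ) + 1) / N with hb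
  have hba : b - a = 1 / N := by rw [ha, hb]; ring
  have hab : a < b := by
    have : 0 < 1 / (N : ℝ) := by positivity
    linarith
  have hsign : 0 ≤ a ∨ b ≤ 0 := by
    rcases le_or_gt 0 (k i) with h | h
    · left
      have : (0 : ℝ) ≤ k i := by exact_mod_cast h
      positivity
    · right
      have : (k i : ℝ) + 1 ≤ 0 := by exact_mod_cast h
      exact div_nonpos_of_nonpos_of_nonneg this hN0.le
  have hmap := map_restrict_latticeCube_eval N k i
  have hev : Measurable (fun y : EuclideanSpace ℝ (Fin 3) => y i) := by fun_prop
  have hint : IntegrableOn (fun s : ℝ => |s| ^ (-(1 / 2) : ℝ)) (Set.Ico a b) :=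
    (intervalIntegrable_iff_integrableOn_Ico_of_le hab.le).mp
      (intervalIntegrable_abs_rpow_neg_half a b)
  have hint_map : Integrable (fun s : ℝ => |s| ^ (-(1 / 2) : ℝ))
      ((volume.restrict (latticeCube N k)).map (fun y => y i)) := by
    rw [hmap]
    exact hint.smul_measure (by finiteness)
  have hne : ∀ᵐ y ∂(volume.restrict (latticeCube N k)), y i ≠ 0 := by
    refine ae_of_ae_map (p := fun s : ℝ => s ≠ 0) hev.aemeasurable ?_
    rw [hmap]
    exact Measure.ae_smul_measure (Measure.ae_ne _ _) _
  have hle : ∫ y in latticeCube N k, ‖y‖ ^ (-(1 / 2) : ℝ) ≤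
      ∫ y in latticeCube N k, |y i| ^ (-(1 / 2) : ℝ) := by
    refine integral_mono_of_nonneg (.of_forall fun y => by positivity)
      (hint_map.comp_measurable hev) ?_
    filter_upwards [hne] with y hy
    exact Real.rpow_le_rpow_of_nonpos (abs_pos.mpr hy) (PiLp.norm_apply_le y i) (by norm_num)
  have hcoord : ∫ y in latticeCube N k, |y i| ^ (-(1 / 2) : ℝ) =
      (1 / N : ℝ) ^ 2 * ∫ s in a..b, |s| ^ (-(1 / 2) : ℝ) := by
    rw [← integral_map hev.aemeasurable hint_map.aestronglyMeasurable, hmap,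
      integral_smul_measure, intervalIntegral.integral_of_le hab.le, integral_Ico_eq_integral_Ioc,
      ENNReal.toReal_pow, ENNReal.toReal_ofReal (by positivity), smul_eq_mul]
  have hbound := integral_abs_rpow_neg_half_le hab hsign ⟨(hx i).1, (hx i).2.le⟩
    (abs_pos.mp hxi)
  have hfour : |x i| ^ (-(1 / 2) : ℝ) ≤ 2 * ‖x‖ ^ (-(1 / 2) : ℝ) := by
    calc |x i| ^ (-(1 / 2) : ℝ) ≤ (‖x‖ / 4) ^ (-(1 / 2) : ℝ) :=
          Real.rpow_le_rpow_of_nonpos (by positivity) (by linarith) (by norm_num)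
      _ = 2 * ‖x‖ ^ (-(1 / 2) : ℝ) := by
          rw [Real.div_rpow hxpos.le (by norm_num), Real.rpow_neg (by norm_num : (0 : ℝ) ≤ 4),
            ← Real.sqrt_eq_rpow, show (4 : ℝ) = 2 ^ 2 by norm_num, Real.sqrt_sq (by norm_num)]
          ring
  rw [hba] at hbound
  calc (N : ℝ) ^ 3 * ∫ y in latticeCube N k, ‖y‖ ^ (-(1 / 2) : ℝ)
      ≤ (N : ℝ) ^ 3 * ((1 / N : ℝ) ^ 2 * (2 * (1 / N) * |x i| ^ (-(1 / 2) : ℝ))) := by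
        rw [hcoord] at hle
        gcongr
        exact hle.trans (by gcongr)
    _ = 2 * |x i| ^ (-(1 / 2) : ℝ) := by field_simp
    _ ≤ 4 * ‖x‖ ^ (-(1 / 2) : ℝ) := by linarith
end
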